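/- arXiv:1801.09181 — 11 statements merged into one kernel-verified Lean document; each statement's English description precedes it below -/
import Mathlib

section
/- For y > 0 and complex u with Re(u) > 0, the iterated improper integral ∫₀^∞ ∫₀^∞ t·cos(2πyt)/(u² + t²) dt dy equals 0. -/
open Complex Filter MeasureTheory Real

lemma den_ge (u : ℂ) (hu : 0 < u.re) (t : ℝ) : u.re ^ 2 ≤ ‖u ^ 2 + (t : ℂ) ^ 2‖ := by
  have h : u ^ 2 + (t : ℂ) ^ 2 = (u + t * I) * (u - t * I) := by
    ring_nf; simp
  rw [h, norm_mul, sq]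
  have h1 : u.re ≤ ‖u + t * I‖ := by
    simpa using (Complex.re_le_norm (u + t * I))
  have h2 : u.re ≤ ‖u - t * I‖ := by
    simpa using (Complex.re_le_norm (u - t * I))
  exact mul_le_mul h1 h2 hu.le (norm_nonneg _)

lemma den_ne (u : ℂ) (hu : 0 < u.re) (t : ℝ) : u ^ 2 + (t : ℂ) ^ 2 ≠ 0 := by
  have := den_ge u hu t
  have h2 : 0 < u.re ^ 2 := by positivity
  exact norm_pos_iff.1 (h2.trans_le this)

lemma inv_bound (u : ℂ) (hu : 0 < u.re) : ∃ K : ℝ, 0 < K ∧ ∀ t : ℝ,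
    ‖(u ^ 2 + (t : ℂ) ^ 2)⁻¹‖ ≤ K * (1 + t ^ 2)⁻¹ := by
  refine ⟨1 + ‖1 - u ^ 2‖ / u.re ^ 2, by positivity, fun t => ?_⟩
  have h0 := den_ne u hu t
  have hg := den_ge u hu t
  have h2 : 0 < u.re ^ 2 := by positivity
  have e : (1 + (t : ℂ) ^ 2) * (u ^ 2 + (t : ℂ) ^ 2)⁻¹
      = 1 + (1 - u ^ 2) * (u ^ 2 + (t : ℂ) ^ 2)⁻¹ := by
    field_simp; ring
  have e2 : ‖(1 + (t : ℂ) ^ 2)‖ = 1 + t ^ 2 := by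
    have : (1 + (t : ℂ) ^ 2) = ((1 + t ^ 2 : ℝ) : ℂ) := by push_cast; rfl
    rw [this, Complex.norm_real, Real.norm_of_nonneg (by positivity)]
  have e3 : (1 + t ^ 2) * ‖(u ^ 2 + (t : ℂ) ^ 2)⁻¹‖ ≤ 1 + ‖1 - u ^ 2‖ / u.re ^ 2 := by
    rw [← e2, ← norm_mul, e]
    refine (norm_add_le _ _).trans ?_
    rw [norm_one, norm_mul, norm_inv, div_eq_mul_inv]
    gcongr
  rw [← div_eq_mul_inv, le_div_iff₀ (by positivity), mul_comm]
  exact e3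

lemma sin_le_sqrt (x : ℝ) (hx : 0 ≤ x) : |Real.sin x| ≤ √x := by
  apply Real.le_sqrt_of_sq_le
  have h1 := Real.abs_sin_le_one x
  have h2 : |Real.sin x| ≤ x := by simpa [abs_of_nonneg hx] using Real.abs_sin_le_abs (x := x)
  nlinarith [abs_nonneg (Real.sin x)]

lemma sqrt_integrable : Integrable (fun t : ℝ => √|t| * (1 + t ^ 2)⁻¹) := by
  have h := integrable_rpow_neg_one_add_norm_sq (E := ℝ) (μ := volume) (r := 3/2) (by norm_num)
  refine h.mono' (by fun_prop) (Eventually.of_forall fun t => ?_)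
  rw [Real.norm_of_nonneg (by positivity)]
  have hp : (0:ℝ) < 1 + t ^ 2 := by positivity
  have e : (1 + ‖t‖ ^ 2 : ℝ) ^ (-(3/2 : ℝ) / 2) = (1 + t ^ 2) ^ (1/4 : ℝ) * (1 + t ^ 2)⁻¹ := by
    rw [Real.norm_eq_abs, sq_abs, ← Real.rpow_neg_one (1 + t ^ 2), ← Real.rpow_add hp]
    norm_num
  rw [e]
  gcongr
  rw [Real.sqrt_eq_rpow]
  have : |t| ^ (1/2 : ℝ) = (t ^ 2) ^ (1/4 : ℝ) := by
    rw [← sq_abs, ← Real.rpow_natCast, ← Real.rpow_mul (abs_nonneg t)]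
    norm_num
  rw [this]
  gcongr
  linarith

lemma T_bound (T : ℝ) (hT : 0 ≤ T) : T * √T * (1 + T ^ 2)⁻¹ ≤ 1 := by
  rw [← div_eq_mul_inv, div_le_one (by positivity)]
  have h1 := Real.sq_sqrt hT
  nlinarith [sq_nonneg (T - 1), Real.sqrt_nonneg T, sq_nonneg (√T - 1), sq_nonneg (√T - T)]

lemma f_deriv (u : ℂ) (hu : 0 < u.re) (t : ℝ) :
    HasDerivAt (fun t : ℝ => (t : ℂ) * (u ^ 2 + (t : ℂ) ^ 2)⁻¹)
      ((u ^ 2 - (t : ℂ) ^ 2) * (u ^ 2 + (t : ℂ) ^ 2)⁻¹ ^ 2) t := by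
  have h0 := den_ne u hu t
  have h1 : HasDerivAt (fun t : ℝ => (t : ℂ)) 1 t := Complex.ofRealCLM.hasDerivAt
  have h2 := h1.mul (((h1.pow 2).const_add (u ^ 2)).inv h0)
  refine HasDerivAt.congr_deriv h2 ?_
  simp only [Pi.pow_apply, Pi.inv_apply]
  field_simp
  push_cast
  ring

lemma main_bound (u : ℂ) (hu : 0 < u.re) : ∃ B : ℝ, ∀ y : ℝ, 0 < y → ∀ T : ℝ, 0 ≤ T →
    ‖∫ t in (0 : ℝ)..T,
        (t : ℂ) * Real.cos (2 * π * y * t) / (u ^ 2 + (t : ℂ) ^ 2)‖ ≤ B * y ^ (-(1/2) : ℝ) := by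
  obtain ⟨K, hK, hb⟩ := inv_bound u hu
  set M : ℝ := ∫ t : ℝ, √|t| * (1 + t ^ 2)⁻¹ with hM
  set L : ℝ := (‖u ^ 2‖ + 1) * K ^ 2 with hL
  refine ⟨(K + L * M) * (√(2 * π))⁻¹, fun y hy T hT => ?_⟩
  set a : ℝ := 2 * π * y with ha
  have hapos : 0 < a := by positivity
  have hc : Continuous fun t : ℝ => (u ^ 2 + (t : ℂ) ^ 2)⁻¹ :=
    Continuous.inv₀ (by fun_prop) (den_ne u hu)
  have hv : ∀ t : ℝ, HasDerivAt (fun t : ℝ => ((Real.sin (a * t) / a : ℝ) : ℂ))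
      ((Real.cos (a * t) : ℝ) : ℂ) t := by
    intro t
    apply HasDerivAt.ofReal_comp
    have h1 : HasDerivAt (fun t : ℝ => a * t) a t := by
      simpa using (hasDerivAt_id t).const_mul a
    refine HasDerivAt.congr_deriv ((h1.sin).div_const a) ?_
    field_simp
  have key := intervalIntegral.integral_mul_deriv_eq_deriv_mul (a := 0) (b := T)
    (fun t _ => f_deriv u hu t) (fun t _ => hv t)
    (Continuous.intervalIntegrable (by fun_prop) _ _)
    (Continuous.intervalIntegrable (by fun_prop) _ _)
  have e : (∫ t in (0 : ℝ)..T,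
        (t : ℂ) * Real.cos (a * t) / (u ^ 2 + (t : ℂ) ^ 2)) =
      ∫ t in (0 : ℝ)..T, (t : ℂ) * (u ^ 2 + (t : ℂ) ^ 2)⁻¹ * ((Real.cos (a * t) : ℝ) : ℂ) := by
    apply intervalIntegral.integral_congr
    intro t _
    simp only [div_eq_mul_inv]; ring
  have hs : ∀ t : ℝ, 0 ≤ t → ‖((Real.sin (a * t) / a : ℝ) : ℂ)‖ ≤ (√a)⁻¹ * √|t| := by
    intro t ht
    rw [Complex.norm_real, Real.norm_eq_abs, abs_div, abs_of_pos hapos, abs_of_nonneg ht,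
      div_le_iff₀ hapos]
    refine (sin_le_sqrt _ (by positivity)).trans (le_of_eq ?_)
    rw [Real.sqrt_mul hapos.le]
    have := Real.sq_sqrt hapos.le
    have h3 : √a ≠ 0 := by positivity
    field_simp
    rw [this]
    ring
  have hsa : (√(2 * π))⁻¹ * y ^ (-(1/2) : ℝ) = (√a)⁻¹ := by
    rw [ha, Real.sqrt_mul (x := 2 * π) (by positivity) y, Real.rpow_neg hy.le, ← Real.sqrt_eq_rpow, mul_inv]
  rw [mul_assoc, hsa, e, key]
  have b1 : ‖(T : ℂ) * (u ^ 2 + (T : ℂ) ^ 2)⁻¹ * ((Real.sin (a * T) / a : ℝ) : ℂ)‖ ≤ K * (√a)⁻¹ := by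
    rw [norm_mul, norm_mul, Complex.norm_real, Real.norm_of_nonneg hT]
    calc _ ≤ T * (K * (1 + T ^ 2)⁻¹) * ((√a)⁻¹ * √|T|) := by
          gcongr
          · exact hb T
          · exact hs T hT
      _ = K * (√a)⁻¹ * (T * √T * (1 + T ^ 2)⁻¹) := by rw [abs_of_nonneg hT]; ring
      _ ≤ K * (√a)⁻¹ * 1 := by gcongr; exact T_bound T hT
      _ = _ := mul_one _
  have b2 : ‖∫ t in (0 : ℝ)..T, (u ^ 2 - (t : ℂ) ^ 2) * (u ^ 2 + (t : ℂ) ^ 2)⁻¹ ^ 2 *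
      ((Real.sin (a * t) / a : ℝ) : ℂ)‖ ≤ L * (√a)⁻¹ * M := by
    calc _ ≤ ∫ t in (0 : ℝ)..T, L * (√a)⁻¹ * (√|t| * (1 + t ^ 2)⁻¹) := by
          apply intervalIntegral.norm_integral_le_of_norm_le hT
          · refine Eventually.of_forall fun t ht => ?_
            rw [norm_mul, norm_mul, norm_pow]
            have h4 : ‖u ^ 2 - (t : ℂ) ^ 2‖ ≤ (‖u ^ 2‖ + 1) * (1 + t ^ 2) := by
              refine (norm_sub_le _ _).trans ?_
              rw [norm_pow (t : ℂ), Complex.norm_real, Real.norm_eq_abs, sq_abs]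
              nlinarith [norm_nonneg (u ^ 2), sq_nonneg t,
                mul_nonneg (norm_nonneg (u ^ 2)) (sq_nonneg t)]
            calc _ ≤ ((‖u ^ 2‖ + 1) * (1 + t ^ 2)) * (K * (1 + t ^ 2)⁻¹) ^ 2 *
                    ((√a)⁻¹ * √|t|) := by
                  gcongr
                  · exact hb t
                  · exact hs t ht.1.le
              _ = _ := by
                  have : (1 + t ^ 2) ≠ 0 := by positivity
                  rw [hL]; field_simp
          · exact (sqrt_integrable.const_mul _).intervalIntegrable
      _ = L * (√a)⁻¹ * ∫ t in (0 : ℝ)..T, (√|t| * (1 + t ^ 2)⁻¹) := by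
          rw [intervalIntegral.integral_const_mul]
      _ ≤ _ := by
          gcongr
          rw [intervalIntegral.integral_of_le hT]
          exact setIntegral_le_integral sqrt_integrable
            (Eventually.of_forall fun t => by positivity)
  simp only [Complex.ofReal_zero, zero_mul, sub_zero]
  refine (norm_sub_le _ _).trans ?_
  refine (add_le_add b1 b2).trans (le_of_eq ?_)
  ring

lemma inv_integrable (u : ℂ) (hu : 0 < u.re) :
    Integrable (fun t : ℝ => (u ^ 2 + (t : ℂ) ^ 2)⁻¹) := by
  obtain ⟨K, hK, hb⟩ := inv_bound u hu
  have hc : Continuous fun t : ℝ => (u ^ 2 + (t : ℂ) ^ 2)⁻¹ :=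
    Continuous.inv₀ (by fun_prop) (den_ne u hu)
  exact (integrable_inv_one_add_sq.const_mul K).mono' hc.aestronglyMeasurable
    (Eventually.of_forall hb)

lemma sin_integrable (u : ℂ) (hu : 0 < u.re) (Y : ℝ) :
    Integrable (fun t : ℝ => ((Real.sin (2 * π * Y * t) / (2 * π) : ℝ) : ℂ) *
      (u ^ 2 + (t : ℂ) ^ 2)⁻¹) := by
  refine (inv_integrable u hu).bdd_mul (c := (2 * π)⁻¹) (by fun_prop)
    (Eventually.of_forall fun t => ?_)
  rw [Complex.norm_real, Real.norm_eq_abs, abs_div, abs_of_pos Real.two_pi_pos, div_eq_mul_inv]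
  have := Real.abs_sin_le_one (2 * π * Y * t)
  have h := inv_pos.2 Real.two_pi_pos
  nlinarith

lemma fubini (u : ℂ) (hu : 0 < u.re) (Y T : ℝ) :
    (∫ y in (0 : ℝ)..Y, ∫ t in (0 : ℝ)..T,
        (t : ℂ) * Real.cos (2 * π * y * t) / (u ^ 2 + (t : ℂ) ^ 2)) =
    ∫ t in (0 : ℝ)..T, ((Real.sin (2 * π * Y * t) / (2 * π) : ℝ) : ℂ) *
      (u ^ 2 + (t : ℂ) ^ 2)⁻¹ := by
  rw [intervalIntegral_intervalIntegral_swap]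
  · apply intervalIntegral.integral_congr
    intro t _
    have hd : ∀ y : ℝ, HasDerivAt (fun y : ℝ => ((Real.sin (2 * π * y * t) / (2 * π) : ℝ) : ℂ) *
        (u ^ 2 + (t : ℂ) ^ 2)⁻¹)
        ((t : ℂ) * Real.cos (2 * π * y * t) / (u ^ 2 + (t : ℂ) ^ 2)) y := by
      intro y
      have h1 : HasDerivAt (fun y : ℝ => 2 * π * y * t) (2 * π * t) y := by
        simpa using ((hasDerivAt_id y).const_mul (2 * π)).mul_const t
      have h2 := ((h1.sin.div_const (2 * π)).ofReal_comp).mul_const ((u ^ 2 + (t : ℂ) ^ 2)⁻¹)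
      refine HasDerivAt.congr_deriv h2 ?_
      have : Real.cos (2 * π * y * t) * (2 * π * t) / (2 * π) = t * Real.cos (2 * π * y * t) := by
        have := Real.pi_ne_zero
        field_simp
      rw [this, div_eq_mul_inv]; push_cast; rfl
    have := intervalIntegral.integral_eq_sub_of_hasDerivAt (a := 0) (b := Y) (fun y _ => hd y)
      (Continuous.intervalIntegrable (by fun_prop) _ _)
    simp only [this]
    simp
  · have : Continuous (Function.uncurry fun (y t : ℝ) =>
        (t : ℂ) * Real.cos (2 * π * y * t) / (u ^ 2 + (t : ℂ) ^ 2)) := by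
      apply Continuous.div (by fun_prop) (by fun_prop)
      rintro ⟨y, t⟩
      exact den_ne u hu t
    exact (this.continuousOn.integrableOn_compact (isCompact_uIcc.prod isCompact_uIcc)).mono_set
      (Set.prod_mono Set.uIoc_subset_uIcc Set.uIoc_subset_uIcc)

lemma riemann_lebesgue (u : ℂ) (hu : 0 < u.re) :
    Tendsto (fun Y : ℝ => ∫ t in Set.Ioi (0 : ℝ),
      ((Real.sin (2 * π * Y * t) / (2 * π) : ℝ) : ℂ) * (u ^ 2 + (t : ℂ) ^ 2)⁻¹)
      atTop (nhds 0) := by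
  set F : ℝ → ℂ := (Set.Ioi (0 : ℝ)).indicator fun t => (u ^ 2 + (t : ℂ) ^ 2)⁻¹ with hF
  have hFi : Integrable F := (inv_integrable u hu).indicator measurableSet_Ioi
  have hRL := Real.tendsto_integral_exp_smul_cocompact F
  have h1 := hRL.comp (tendsto_id.mono_right atTop_le_cocompact)
  have h2 := hRL.comp (tendsto_neg_atTop_atBot.mono_right atBot_le_cocompact)
  have h3 := (h2.sub h1).const_mul ((4 * π * I)⁻¹)
  simp only [sub_zero, mul_zero] at h3
  refine h3.congr fun Y => ?_
  have hint : ∀ w : ℝ, Integrable (fun v : ℝ => Real.fourierChar (-(v * w)) • F v) := by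
    intro w
    simp only [Circle.smul_def, smul_eq_mul]
    refine hFi.bdd_mul (c := 1) (Continuous.aestronglyMeasurable ?_)
      (Eventually.of_forall fun v => (Circle.norm_coe _).le)
    simp only [Real.fourierChar_apply]
    fun_prop
  simp only [Function.comp, id]
  rw [← integral_sub (hint _) (hint _), ← integral_const_mul, ← integral_indicator measurableSet_Ioi]
  congr 1
  ext t
  by_cases ht : t ∈ Set.Ioi (0 : ℝ)
  · simp only [hF, Set.indicator_of_mem ht, Circle.smul_def, Real.fourierChar_apply, smul_eq_mul]
    push_cast
    rw [Complex.sin]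
    have := Real.pi_ne_zero
    have hp : (π : ℂ) ≠ 0 := by exact_mod_cast this
    have e1 : 2 * (π : ℂ) * -(t * -Y) * I = (2 * π * Y * t) * I := by ring
    have e2 : 2 * (π : ℂ) * -(t * Y) * I = -(2 * π * Y * t) * I := by ring
    rw [e1, e2]
    generalize cexp (2 * π * Y * t * I) = p
    generalize cexp (-(2 * π * Y * t) * I) = q
    generalize (u ^ 2 + (t : ℂ) ^ 2)⁻¹ = r
    have hI : (I : ℂ)⁻¹ = -I := Complex.inv_I
    rw [mul_inv, hI]
    field_simp
    ring
  · simp [hF, Set.indicator_of_notMem ht]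

theorem zero_double_integral (u : ℂ) (hu : 0 < u.re) (R : ℝ → ℂ)
    (hR : ∀ y : ℝ, 0 < y → Filter.Tendsto
      (fun T : ℝ => ∫ t in (0 : ℝ)..T,
        (t : ℂ) * Real.cos (2 * π * y * t) / (u ^ 2 + (t : ℂ) ^ 2))
      Filter.atTop (nhds (R y))) :
    Filter.Tendsto (fun Y : ℝ => ∫ y in (0 : ℝ)..Y, R y) Filter.atTop (nhds 0) := by
  refine (riemann_lebesgue u hu).congr' ?_
  filter_upwards [eventually_ge_atTop 0] with Y hY
  obtain ⟨B, hB⟩ := main_bound u hu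
  have h1 := intervalIntegral_tendsto_integral_Ioi 0 (sin_integrable u hu Y).integrableOn tendsto_id
  have h2 : Tendsto (fun T : ℝ => ∫ y in (0 : ℝ)..Y, ∫ t in (0 : ℝ)..T,
        (t : ℂ) * Real.cos (2 * π * y * t) / (u ^ 2 + (t : ℂ) ^ 2)) atTop
      (nhds (∫ y in (0 : ℝ)..Y, R y)) := by
    apply intervalIntegral.tendsto_integral_filter_of_dominated_convergence
      (fun y => B * y ^ (-(1/2) : ℝ))
    · refine Eventually.of_forall fun T => Continuous.aestronglyMeasurable ?_
      apply intervalIntegral.continuous_parametric_intervalIntegral_of_continuous'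
      apply Continuous.div (by fun_prop) (by fun_prop)
      rintro ⟨y, t⟩
      exact den_ne u hu t
    · filter_upwards [eventually_ge_atTop 0] with T hT
      refine Eventually.of_forall fun y hy => ?_
      rw [Set.uIoc_of_le hY] at hy
      exact hB y hy.1 T hT
    · exact (intervalIntegral.intervalIntegrable_rpow' (by norm_num)).const_mul B
    · refine Eventually.of_forall fun y hy => ?_
      rw [Set.uIoc_of_le hY] at hy
      exact hR y hy.1
  simp only [fubini u hu] at h2
  exact tendsto_nhds_unique h1 h2
end

section
/- For complex s with 0 < Re(s) < 2 and complex u with Re(u) > 0, (1/(2πi)) ∫_{(c₁)} Γ(s)/tan(πs/2) · u^{−s} ds = (2/π) ∫₀^∞ t·cos(t)/(u² + t²) dt, where the contour integral is taken along the vertical line Re(s) = c₁ with 0 < c₁ < 2. -/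
open Complex Filter MeasureTheory Real

lemma rc_int_rpow_exp {σ b : ℝ} (hσ : 0 < σ) (hb : 0 < b) :
    IntegrableOn (fun x : ℝ => x ^ (σ - 1) * Real.exp (-(b * x))) (Set.Ioi 0) := by
  have := integrableOn_rpow_mul_exp_neg_mul_rpow (p := 1) (s := σ - 1) (b := b) (by linarith)
    one_pos hb
  simpa using this

lemma rc_norm_integrand (s r : ℂ) {x : ℝ} (hx : 0 < x) :
    ‖(x : ℂ) ^ (s - 1) * Complex.exp (-(r * x))‖ = x ^ (s.re - 1) * Real.exp (-(r.re * x)) := by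
  rw [norm_mul, norm_cpow_eq_rpow_re_of_pos hx, Complex.norm_exp]
  simp

lemma rc_aesm (s r : ℂ) : AEStronglyMeasurable
    (fun t : ℝ => (t : ℂ) ^ (s - 1) * Complex.exp (-(r * t))) (volume.restrict (Set.Ioi 0)) := by
  refine ContinuousOn.aestronglyMeasurable ?_ measurableSet_Ioi
  refine ContinuousOn.mul (fun x hx => ?_) (by fun_prop)
  exact (Complex.continuousAt_ofReal_cpow_const _ _ (Or.inr (ne_of_gt hx))).continuousWithinAt

lemma rc_integrable {s r : ℂ} (hs : 0 < s.re) (hr : 0 < r.re) : IntegrableOn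
    (fun t : ℝ => (t : ℂ) ^ (s - 1) * Complex.exp (-(r * t))) (Set.Ioi 0) := by
  refine (rc_int_rpow_exp hs hr).mono' (rc_aesm s r) ?_
  filter_upwards [ae_restrict_mem measurableSet_Ioi] with x hx
  exact (rc_norm_integrand s r hx).le

lemma rc_laplace {a r : ℂ} (ha : 0 < a.re) (hr : 0 < r.re) :
    ∫ t in Set.Ioi (0:ℝ), (t : ℂ) ^ (a - 1) * Complex.exp (-(r * t))
      = (1 / r) ^ a * Complex.Gamma a := by
  set U : Set ℂ := {z | 0 < z.re} with hU
  have hUo : IsOpen U := isOpen_lt continuous_const Complex.continuous_re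
  have hUc : IsPreconnected U := (convex_halfSpace_re_gt 0).isPreconnected
  have h1 : DifferentiableOn ℂ
      (fun r : ℂ => ∫ t in Set.Ioi (0:ℝ), (t : ℂ) ^ (a - 1) * Complex.exp (-(r * t))) U := by
    intro r0 hr0
    have hr0 : 0 < r0.re := hr0
    refine DifferentiableAt.differentiableWithinAt ?_
    have := hasDerivAt_integral_of_dominated_loc_of_deriv_le (𝕜 := ℂ)
      (μ := volume.restrict (Set.Ioi (0:ℝ)))
      (F := fun (r : ℂ) (t : ℝ) => (t : ℂ) ^ (a - 1) * Complex.exp (-(r * t)))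
      (F' := fun (r : ℂ) (t : ℝ) => (t : ℂ) ^ (a - 1) * (Complex.exp (-(r * t)) * (-t)))
      (x₀ := r0) (s := Metric.ball r0 (r0.re / 2))
      (bound := fun t : ℝ => t ^ ((a.re + 1) - 1) * Real.exp (-(r0.re / 2 * t)))
      (Metric.ball_mem_nhds _ (by positivity)) (Eventually.of_forall fun r => rc_aesm a r)
      (rc_integrable ha hr0) ?_ ?_ (rc_int_rpow_exp (by positivity) (by positivity)) ?_
    · exact this.2.differentiableAt
    · have h := (rc_aesm a r0).mul
        (continuous_ofReal.neg.aestronglyMeasurable (μ := volume.restrict (Set.Ioi (0:ℝ))))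
      refine h.congr (Eventually.of_forall fun t => ?_)
      simp only [Pi.mul_apply, Pi.neg_apply]
      ring
    · filter_upwards [ae_restrict_mem measurableSet_Ioi] with t ht r hr
      have ht : (0:ℝ) < t := ht
      rw [← mul_assoc, norm_mul, rc_norm_integrand a r ht, norm_neg, Complex.norm_real,
        Real.norm_of_nonneg ht.le, mul_right_comm, ← Real.rpow_add_one ht.ne']
      rw [show a.re - 1 + 1 = a.re + 1 - 1 by ring]
      gcongr
      have h2 : |(r - r0).re| < r0.re / 2 :=
        (Complex.abs_re_le_norm _).trans_lt (by simpa [dist_eq_norm] using hr)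
      have := (abs_lt.1 h2).1
      simp only [sub_re] at this
      linarith
    · refine Eventually.of_forall fun t r _ => ?_
      refine HasDerivAt.const_mul _ ?_
      have h3 : HasDerivAt (fun r : ℂ => -(r * (t:ℂ))) (-(t:ℂ)) r := by
        simpa using ((hasDerivAt_id r).mul_const (t:ℂ)).fun_neg
      exact h3.cexp
  have h2 : DifferentiableOn ℂ (fun r : ℂ => (1 / r) ^ a * Complex.Gamma a) U := by
    intro z hz
    have hz : 0 < z.re := hz
    have hz0 : z ≠ 0 := by rintro rfl; simp at hz
    refine DifferentiableAt.differentiableWithinAt ?_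
    refine DifferentiableAt.mul_const ?_ _
    refine DifferentiableAt.cpow_const ?_ ?_
    · exact (differentiableAt_const _).div differentiableAt_id hz0
    · left
      rw [one_div, Complex.inv_re]
      exact div_pos hz (Complex.normSq_pos.2 hz0)
  refine (h1.analyticOnNhd hUo).eqOn_of_preconnected_of_frequently_eq (h2.analyticOnNhd hUo) hUc
    (z₀ := 1) (by simp [hU]) ?_ hr
  have hseq : Tendsto (fun n : ℕ => ((1 + 1 / ((n:ℝ) + 1) : ℝ) : ℂ)) atTop (nhdsWithin 1 {1}ᶜ) := by
    refine tendsto_nhdsWithin_iff.2 ⟨?_, Eventually.of_forall fun n => ?_⟩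
    · have := (continuous_ofReal.tendsto _).comp
        ((tendsto_one_div_add_atTop_nhds_zero_nat (𝕜 := ℝ)).const_add 1)
      simpa [Function.comp_def] using this
    · have : (0:ℝ) < 1 / ((n:ℝ) + 1) := by positivity
      intro h
      have h : ((1 + 1 / ((n:ℝ) + 1) : ℝ) : ℂ) = 1 := h
      have : (1 + 1 / ((n:ℝ) + 1) : ℝ) = 1 := by exact_mod_cast h
      linarith
  refine hseq.frequently (Eventually.frequently (Eventually.of_forall fun n => ?_))
  exact Complex.integral_cpow_mul_exp_neg_mul_Ioi ha (by positivity)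

lemma rc_gamma_rot {σ θ : ℝ} (hσ : 0 < σ) (hθ : |θ| < π / 2) (y : ℝ) :
    ‖Complex.Gamma (σ + y * I)‖ ≤
      (∫ x in Set.Ioi (0 : ℝ), x ^ (σ - 1) * Real.exp (-(Real.cos θ * x))) * Real.exp (-(θ * y)) := by
  have hθ' := abs_lt.1 hθ
  have hre : (Complex.exp (θ * I)).re = Real.cos θ := Complex.exp_ofReal_mul_I_re θ
  have hcos : 0 < Real.cos θ := Real.cos_pos_of_mem_Ioo ⟨by linarith, by linarith⟩
  have h := rc_laplace (a := σ + y * I) (r := Complex.exp (θ * I))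
    (by simpa using hσ) (by rw [hre]; exact hcos)
  have hn : ‖(1 / Complex.exp (θ * I)) ^ (σ + y * I : ℂ)‖ = Real.exp (θ * y) := by
    rw [Complex.norm_cpow_of_ne_zero (by simp), one_div, ← Complex.exp_neg,
      show -((θ : ℂ) * I) = ((-θ : ℝ) : ℂ) * I by push_cast; ring, Complex.norm_exp_ofReal_mul_I,
      Complex.arg_exp_mul_I, (toIocMod_eq_self _).2]
    · simp [← Real.exp_neg]
    · constructor <;> linarith [Real.pi_pos]
  have h2 : ‖∫ t in Set.Ioi (0:ℝ), (t : ℂ) ^ (σ + y * I - 1 : ℂ) * Complex.exp (-(Complex.exp (θ * I) * t))‖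
      ≤ ∫ x in Set.Ioi (0 : ℝ), x ^ (σ - 1) * Real.exp (-(Real.cos θ * x)) := by
    refine (norm_integral_le_integral_norm _).trans (le_of_eq ?_)
    refine setIntegral_congr_fun measurableSet_Ioi fun x hx => ?_
    rw [rc_norm_integrand _ _ hx, hre]
    simp
  rw [h, norm_mul, hn] at h2
  rw [Real.exp_neg, ← div_eq_mul_inv, le_div_iff₀ (Real.exp_pos _), mul_comm]
  exact h2

lemma rc_gamma_bound {σ θ : ℝ} (hσ : 0 < σ) (hθ0 : 0 ≤ θ) (hθ : θ < π / 2) :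
    ∃ C : ℝ, 0 ≤ C ∧ ∀ y : ℝ, ‖Complex.Gamma (σ + y * I)‖ ≤ C * Real.exp (-(θ * |y|)) := by
  refine ⟨∫ x in Set.Ioi (0 : ℝ), x ^ (σ - 1) * Real.exp (-(Real.cos θ * x)), ?_, fun y => ?_⟩
  · refine setIntegral_nonneg measurableSet_Ioi fun x hx => ?_
    have : (0:ℝ) < x := hx
    positivity
  · rcases le_total 0 y with hy | hy
    · rw [abs_of_nonneg hy]
      exact rc_gamma_rot hσ (by rwa [abs_of_nonneg hθ0]) y
    · rw [abs_of_nonpos hy]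
      have := rc_gamma_rot (θ := -θ) hσ (by rwa [abs_neg, abs_of_nonneg hθ0]) y
      simpa using this

lemma rc_exp_abs {k : ℝ} (hk : 0 < k) : Integrable (fun y : ℝ => Real.exp (-(k * |y|))) := by
  have h1 : IntegrableOn (fun y : ℝ => Real.exp (-(k * |y|))) (Set.Ioi 0) := by
    refine (integrableOn_exp_mul_Ioi (neg_lt_zero.2 hk) 0).congr_fun (fun x hx => ?_) measurableSet_Ioi
    have : (0:ℝ) < x := hx
    simp [abs_of_pos this]
  have h2 : IntegrableOn (fun y : ℝ => Real.exp (-(k * |y|))) (Set.Iic 0) := by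
    refine (integrableOn_exp_mul_Iic hk 0).congr_fun (fun x hx => ?_) measurableSet_Iic
    have : x ≤ 0 := hx
    simp [abs_of_nonpos this]
  rw [← integrableOn_univ, ← Set.Iic_union_Ioi (a := (0:ℝ))]
  exact h2.union h1

lemma rc_cpow_bound {u : ℂ} (hu : u ≠ 0) {A : ℝ} (hA : |u.arg| ≤ A) (s : ℂ) :
    ‖u ^ s‖ ≤ ‖u‖ ^ s.re * Real.exp (A * |s.im|) := by
  rw [Complex.norm_cpow_of_ne_zero hu, div_eq_mul_inv, ← Real.exp_neg]
  gcongr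
  calc -(u.arg * s.im) ≤ |u.arg * s.im| := neg_le_abs _
    _ = |u.arg| * |s.im| := abs_mul _ _
    _ ≤ _ := by gcongr

lemma rc_abel {f : ℝ → ℂ} (hf : Continuous f) {R : ℂ} {M : ℝ} (hM : ∀ t, ‖f t‖ ≤ M)
    (hR : Tendsto (fun T : ℝ => ∫ t in (0:ℝ)..T, f t) atTop (nhds R)) :
    Tendsto (fun n : ℕ => ∫ t in Set.Ioi (0:ℝ), Complex.exp (-((1 / ((n:ℝ) + 1) : ℝ) * t)) * f t)
      atTop (nhds R) := by
  set F : ℝ → ℂ := fun T => ∫ t in (0:ℝ)..T, f t with hF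
  have hFd : ∀ x, HasDerivAt F (f x) x := fun x => hf.integral_hasStrictDerivAt 0 x |>.hasDerivAt
  have hFc : Continuous F := continuous_iff_continuousAt.2 fun x => (hFd x).continuousAt
  obtain ⟨B, hB⟩ : ∃ B, ∀ t, 0 ≤ t → ‖F t‖ ≤ B := by
    have h1 : ∀ᶠ t in atTop, ‖F t‖ ≤ ‖R‖ + 1 :=
      (hR.norm.eventually (gt_mem_nhds (lt_add_one _))).mono fun t ht => le_of_lt ht
    obtain ⟨T, hT⟩ := eventually_atTop.1 h1
    obtain ⟨B, hB⟩ := (isCompact_Icc (a := (0:ℝ)) (b := T)).exists_bound_of_continuousOn hFc.continuousOn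
    refine ⟨max B (‖R‖ + 1), fun t ht => ?_⟩
    rcases le_total t T with h | h
    · exact (hB t ⟨ht, h⟩).trans (le_max_left _ _)
    · exact (hT t h).trans (le_max_right _ _)
  have key : ∀ ε : ℝ, 0 < ε → ∫ t in Set.Ioi (0:ℝ), Complex.exp (-(ε * t)) * f t
      = ∫ x in Set.Ioi (0:ℝ), Complex.exp (-x) * F (ε⁻¹ * x) := by
    intro ε hε
    have hEint : IntegrableOn (fun t : ℝ => Complex.exp (-((ε:ℂ) * t))) (Set.Ioi 0) := by
      have := integrableOn_exp_mul_complex_Ioi (a := -(ε:ℂ)) (by simpa using hε) 0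
      simpa using this
    have hd : ∀ x ∈ Set.Ioi (0:ℝ), HasDerivAt (fun t : ℝ => Complex.exp (-((ε:ℂ) * t)))
        (-ε * Complex.exp (-((ε:ℂ) * x))) x := by
      intro x _
      have h1 : HasDerivAt (fun t : ℝ => -((ε:ℂ) * t)) (-ε) x := by
        simpa using ((hasDerivAt_id x).ofReal_comp.const_mul (ε:ℂ)).fun_neg
      have := h1.cexp
      convert this using 1; ring
    have hc : Continuous (fun t : ℝ => Complex.exp (-((ε:ℂ) * t))) := by fun_prop
    have hip := integral_Ioi_mul_deriv_eq_deriv_mul (a := (0:ℝ)) (a' := (0:ℂ)) (b' := (0:ℂ))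
      (u := fun t : ℝ => Complex.exp (-((ε:ℂ) * t))) (v := F)
      (u' := fun x : ℝ => -ε * Complex.exp (-((ε:ℂ) * x))) (v' := f)
      hd (fun x _ => hFd x) ?_ ?_ ?_ ?_
    · rw [hip]
      have hs := integral_comp_mul_left_Ioi (fun x : ℝ => Complex.exp (-x) * F (ε⁻¹ * x)) 0 hε
      have e : ∀ x : ℝ, ε⁻¹ * (ε * x) = x := fun x => by field_simp
      simp only [e, mul_zero] at hs
      have e2 : ∀ x : ℝ, -(ε:ℂ) * Complex.exp (-((ε:ℂ) * x)) * F x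
        = (-(ε:ℂ)) * (Complex.exp (-((ε * x : ℝ) : ℂ)) * F x) := fun x => by push_cast; ring
      simp only [e2]
      rw [integral_const_mul, hs, Complex.real_smul]
      have : (ε:ℂ) ≠ 0 := by exact_mod_cast hε.ne'
      push_cast
      field_simp
      ring
    · exact hEint.mul_bdd (c := M) hf.aestronglyMeasurable.restrict (Eventually.of_forall hM)
    · have : IntegrableOn (fun x : ℝ => -(ε:ℂ) * Complex.exp (-((ε:ℂ) * x))) (Set.Ioi 0) :=
        hEint.const_mul _
      refine this.mul_bdd (c := B) hFc.aestronglyMeasurable.restrict ?_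
      filter_upwards [ae_restrict_mem measurableSet_Ioi] with x hx using hB x (le_of_lt hx)
    · have : Tendsto ((fun t : ℝ => Complex.exp (-((ε:ℂ) * t))) * F) (nhds 0) (nhds 0) := by
        have := (hc.mul hFc).tendsto 0
        simpa [hF] using this
      exact this.mono_left nhdsWithin_le_nhds
    · have h0 : Tendsto (fun t : ℝ => Complex.exp (-((ε:ℂ) * t))) atTop (nhds 0) := by
        rw [Complex.tendsto_exp_nhds_zero_iff]
        simpa using tendsto_id.const_mul_atTop hε
      have := h0.mul hR
      rw [zero_mul] at this
      exact this
  have hlim : Tendsto (fun n : ℕ => ∫ x in Set.Ioi (0:ℝ),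
      Complex.exp (-x) * F ((1 / ((n:ℝ) + 1))⁻¹ * x)) atTop
      (nhds (∫ x in Set.Ioi (0:ℝ), Complex.exp (-x) * R)) := by
    refine tendsto_integral_of_dominated_convergence (fun x : ℝ => Real.exp (-x) * B) ?_ ?_ ?_ ?_
    · intro n
      exact (by fun_prop : Continuous _).aestronglyMeasurable
    · exact (by simpa using integrableOn_exp_mul_Ioi (a := -1) (by norm_num) 0 :
        IntegrableOn (fun x : ℝ => Real.exp (-x)) (Set.Ioi 0)).mul_const B
    · intro n
      filter_upwards [ae_restrict_mem measurableSet_Ioi] with x hx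
      have hx : (0:ℝ) < x := hx
      rw [norm_mul, Complex.norm_exp]
      simp only [neg_re, ofReal_re]
      gcongr
      exact hB _ (by positivity)
    · filter_upwards [ae_restrict_mem measurableSet_Ioi] with x hx
      have hx : (0:ℝ) < x := hx
      refine Tendsto.const_mul _ (hR.comp ?_)
      refine Tendsto.atTop_mul_const hx ?_
      simp only [one_div, inv_inv]
      exact tendsto_natCast_atTop_atTop.atTop_add tendsto_const_nhds
  have hI : ∫ x in Set.Ioi (0:ℝ), Complex.exp (-x) * R = R := by
    rw [integral_mul_const]
    have := integral_exp_mul_complex_Ioi (a := -1) (by simp) 0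
    simp only [neg_mul, one_mul] at this
    rw [this]; simp
  rw [hI] at hlim
  refine hlim.congr fun n => (key _ (by positivity)).symm

lemma rc_cpow_real_mul {y : ℝ} (hy : 0 < y) {x : ℂ} (hx : x ≠ 0) (w : ℂ) :
    ((y : ℂ) * x) ^ w = (y : ℂ) ^ w * x ^ w := by
  have hy' : (y : ℂ) ≠ 0 := by exact_mod_cast hy.ne'
  rw [Complex.cpow_def_of_ne_zero (mul_ne_zero hy' hx), Complex.cpow_def_of_ne_zero hy',
    Complex.cpow_def_of_ne_zero hx, Complex.log_ofReal_mul hy hx, ← Complex.ofReal_log hy.le,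
    ← Complex.exp_add, add_mul]

lemma rc_phase {z : ℂ} (hz : 0 < z.re) (w : ℂ) :
    (starRingEnd ℂ z) * ((1 / (((‖z‖ ^ 2 : ℝ) : ℂ) * z)) ^ w
      * (1 / starRingEnd ℂ z) ^ (1 - w)) = z ^ (-(2 * w)) := by
  have hz0 : z ≠ 0 := by rintro rfl; simp at hz
  have hc0 : starRingEnd ℂ z ≠ 0 := by simpa using hz0
  have hn : 0 < ‖z‖ := norm_pos_iff.2 hz0
  have harg : |z.arg| < π / 2 := Complex.abs_arg_lt_pi_div_two_iff.2 (Or.inl hz)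
  have hapi : z.arg ≠ π := by
    intro h; rw [h, abs_of_pos Real.pi_pos] at harg; linarith [Real.pi_pos]
  have hp0 : ((‖z‖ ^ 2 : ℝ) : ℂ) * z ≠ 0 := mul_ne_zero (by exact_mod_cast (by positivity)) hz0
  have e1 : Complex.log (1 / (((‖z‖ ^ 2 : ℝ) : ℂ) * z)) = -(2 * Real.log ‖z‖ + Complex.log z) := by
    rw [one_div, Complex.log_inv, Complex.log_ofReal_mul (by positivity) hz0, Real.log_pow]
    · push_cast; ring
    · rw [Complex.arg_real_mul _ (by positivity)]; exact hapi
  have e2 : Complex.log (1 / starRingEnd ℂ z) = -starRingEnd ℂ (Complex.log z) := by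
    rw [one_div, Complex.log_inv, Complex.log_conj _ hapi]
    rw [Complex.arg_conj, if_neg hapi]
    intro h
    rw [← abs_neg, h, abs_of_pos Real.pi_pos] at harg; linarith [Real.pi_pos]
  have e3 : starRingEnd ℂ z = Complex.exp (starRingEnd ℂ (Complex.log z)) := by
    rw [Complex.exp_conj, Complex.exp_log hz0]
  have e4 : Complex.log z + starRingEnd ℂ (Complex.log z) = 2 * Real.log ‖z‖ := by
    rw [Complex.add_conj, Complex.log_re]; push_cast; ring
  rw [Complex.cpow_def_of_ne_zero (one_div_ne_zero hp0),
    Complex.cpow_def_of_ne_zero (one_div_ne_zero hc0), Complex.cpow_def_of_ne_zero hz0, e1, e2]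
  nth_rw 1 [e3]
  rw [← Complex.exp_add, ← Complex.exp_add, ← e4]
  congr 1
  ring

lemma rc_mellin_aux {z w : ℂ} (hz : 0 < z.re) (hw0 : 0 < w.re) (hw1 : w.re < 1) :
    MellinConvergent (fun v : ℝ => 1 / (1 + (v : ℂ) * z ^ 2)) w ∧
    mellin (fun v : ℝ => 1 / (1 + (v : ℂ) * z ^ 2)) w
      = Complex.Gamma w * Complex.Gamma (1 - w) * z ^ (-(2 * w)) := by
  have hz0 : z ≠ 0 := by rintro rfl; simp at hz
  set a : ℂ := starRingEnd ℂ z with ha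
  set p : ℂ := ((‖z‖ ^ 2 : ℝ) : ℂ) * z with hp
  have hn : 0 < ‖z‖ := norm_pos_iff.2 hz0
  have hare : 0 < a.re := by simpa [ha] using hz
  have hpre : 0 < p.re := by
    rw [hp, Complex.re_ofReal_mul]; positivity
  have ha0 : a ≠ 0 := by simpa [ha] using hz0
  have hp0 : p ≠ 0 := by intro h; rw [h] at hpre; simp at hpre
  have hap : a * z ^ 2 = p := by
    rw [hp, ha, ← Complex.normSq_eq_norm_sq, Complex.normSq_eq_conj_mul_self]; ring
  set μ : Measure ℝ := volume.restrict (Set.Ioi (0:ℝ)) with hμ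
  set F : ℝ → ℝ → ℂ := fun v y =>
    (v : ℂ) ^ (w - 1) * Complex.exp (-((y * p) * v)) * (a * Complex.exp (-(a * y))) with hF
  -- inner integral in y
  have hiy : ∀ v ∈ Set.Ioi (0:ℝ), ∫ y, F v y ∂μ = (v : ℂ) ^ (w - 1) • (1 / (1 + (v : ℂ) * z ^ 2)) := by
    intro v hv
    have hv : (0:ℝ) < v := hv
    have hre : (-(a + v * p)).re < 0 := by
      simp only [neg_re, add_re, Complex.re_ofReal_mul]
      have := mul_pos hv hpre
      linarith
    have h := integral_exp_mul_complex_Ioi hre 0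
    have hne : a + v * p ≠ 0 := by
      intro h; rw [h] at hre; simp at hre
    have e : ∀ y : ℝ, F v y = ((v : ℂ) ^ (w - 1) * a) * Complex.exp (-(a + v * p) * y) := by
      intro y
      rw [hF]
      simp only
      rw [show -(a + v * p) * (y:ℂ) = -((y * p) * v) + -(a * y) by ring, Complex.exp_add]
      ring
    simp only [e, hμ]
    rw [integral_const_mul, h, smul_eq_mul]
    have h5 : a + v * p = a * (1 + v * z ^ 2) := by rw [← hap]; ring
    have h6 : 1 + v * z ^ 2 ≠ 0 := by
      intro h; rw [h5, h] at hne; simp at hne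
    rw [h5]
    simp
    field_simp
  have hmeas : AEStronglyMeasurable (Function.uncurry F) (μ.prod μ) := by
    rw [hμ, Measure.prod_restrict]
    refine ContinuousOn.aestronglyMeasurable ?_ (measurableSet_Ioi.prod measurableSet_Ioi)
    simp only [Function.uncurry_def, hF]
    refine ContinuousOn.mul (ContinuousOn.mul (fun x hx => ?_) (by fun_prop)) (by fun_prop)
    have h1 : ContinuousAt (fun v : ℝ => (v:ℂ) ^ (w - 1)) x.1 :=
      Complex.continuousAt_ofReal_cpow_const _ _ (Or.inr (ne_of_gt hx.1))
    exact (ContinuousAt.comp (f := Prod.fst) h1 continuousAt_fst).continuousWithinAt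
  have hint : Integrable (Function.uncurry F) (μ.prod μ) := by
    rw [integrable_prod_iff' hmeas]
    constructor
    · filter_upwards [ae_restrict_mem measurableSet_Ioi] with y hy
      have hy : (0:ℝ) < y := hy
      exact (rc_integrable (r := y * p) hw0
        (by rw [Complex.re_ofReal_mul]; positivity)).mul_const (a * Complex.exp (-(a * y)))
    · have hw : 0 < 1 - w.re := by linarith
      have hb := (rc_int_rpow_exp hw hare).const_mul
        (‖a‖ * ((1 / p.re) ^ w.re * Real.Gamma w.re))
      refine IntegrableOn.congr_fun hb (fun y hy => ?_) measurableSet_Ioi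
      have hy : (0:ℝ) < y := hy
      have e : ∀ v ∈ Set.Ioi (0:ℝ), ‖F v y‖ =
          v ^ (w.re - 1) * Real.exp (-((y * p.re) * v)) * (‖a‖ * Real.exp (-(a.re * y))) := by
        intro v hv
        simp only [hF]
        rw [norm_mul, rc_norm_integrand w (y * p) hv, norm_mul, Complex.norm_exp,
          Complex.re_ofReal_mul]
        simp
      simp only [Function.uncurry_apply_pair]
      rw [hμ, setIntegral_congr_fun measurableSet_Ioi e, integral_mul_const,
        Real.integral_rpow_mul_exp_neg_mul_Ioi hw0 (by positivity)]
      have : (1 / (y * p.re)) ^ w.re = y ^ (1 - w.re - 1) * (1 / p.re) ^ w.re := by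
        rw [show 1 / (y * p.re) = y⁻¹ * (1 / p.re) by field_simp,
          Real.mul_rpow (by positivity) (by positivity), Real.inv_rpow hy.le,
          ← Real.rpow_neg hy.le]
        congr 2; ring
      rw [this]
      ring
  constructor
  · have := hint.integral_prod_left
    refine IntegrableOn.congr_fun (f := fun v => ∫ y, F v y ∂μ) this (fun v hv => ?_) measurableSet_Ioi
    exact hiy v hv
  · rw [mellin, ← setIntegral_congr_fun measurableSet_Ioi hiy]
    change ∫ v, ∫ y, F v y ∂μ ∂μ = _
    rw [integral_integral_swap hint]
    have e : ∀ y ∈ Set.Ioi (0:ℝ), ∫ v, F v y ∂μ =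
        (Complex.Gamma w * (a * (1 / p) ^ w)) * ((y:ℂ) ^ ((1 - w) - 1) * Complex.exp (-(a * y))) := by
      intro y hy
      have hy : (0:ℝ) < y := hy
      have hy' : (y:ℂ) ≠ 0 := by exact_mod_cast hy.ne'
      simp only [hF, hμ]
      rw [integral_mul_const, rc_laplace hw0 (by rw [Complex.re_ofReal_mul]; positivity)]
      have : (1 / ((y:ℂ) * p)) ^ w = (y:ℂ) ^ ((1 - w) - 1) * (1 / p) ^ w := by
        rw [show 1 / ((y:ℂ) * p) = ((y⁻¹ : ℝ) : ℂ) * (1 / p) by push_cast; field_simp,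
          rc_cpow_real_mul (by positivity) (one_div_ne_zero hp0)]
        congr 1
        push_cast
        rw [Complex.inv_cpow, ← Complex.cpow_neg]
        · congr 1; ring
        · rw [Complex.arg_ofReal_of_nonneg hy.le]; exact Real.pi_pos.ne
      rw [this]; ring
    rw [hμ, setIntegral_congr_fun measurableSet_Ioi e, integral_const_mul,
      rc_laplace (by simpa using hw1) hare, ← rc_phase hz w]
    ring

lemma rc_mellin {z s : ℂ} (hz : 0 < z.re) (hs0 : 0 < s.re) (hs2 : s.re < 2) :
    MellinConvergent (fun x : ℝ => 1 / (1 + (x : ℂ) ^ 2 * z ^ 2)) s ∧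
    mellin (fun x : ℝ => 1 / (1 + (x : ℂ) ^ 2 * z ^ 2)) s
      = 1 / 2 * (Complex.Gamma (s / 2) * Complex.Gamma (1 - s / 2)) * z ^ (-s) := by
  have hre : (s / 2).re = s.re / 2 := by
    rw [show s / 2 = s / ((2:ℝ):ℂ) by norm_num, Complex.div_ofReal_re]
  obtain ⟨h1, h2⟩ := rc_mellin_aux (z := z) (w := s / 2) hz (by rw [hre]; linarith)
    (by rw [hre]; linarith)
  have e : (fun x : ℝ => 1 / (1 + (x : ℂ) ^ 2 * z ^ 2)) =
      fun x : ℝ => (fun v : ℝ => 1 / (1 + (v : ℂ) * z ^ 2)) (x ^ (2:ℝ)) := by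
    funext x; simp
  rw [e]
  constructor
  · refine (MellinConvergent.comp_rpow (f := fun v : ℝ => 1 / (1 + (v : ℂ) * z ^ 2))
      two_ne_zero).2 ?_
    simpa using h1
  · rw [mellin_comp_rpow (fun v : ℝ => 1 / (1 + (v : ℂ) * z ^ 2))]
    push_cast
    rw [h2, Complex.real_smul]
    have : 2 * (s / 2) = s := by ring
    rw [this]
    simp
    ring

noncomputable def rcK (u : ℂ) (c : ℝ) (y : ℝ) : ℂ :=
  1 / 2 * (Complex.Gamma (((c : ℂ) + y * I) / 2) * Complex.Gamma (1 - ((c : ℂ) + y * I) / 2))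
    * u ^ (-((c : ℂ) + y * I))

lemma rc_half (c y : ℝ) : ((c : ℂ) + y * I) / 2 = ((c / 2 : ℝ) : ℂ) + ((y / 2 : ℝ) : ℂ) * I := by
  push_cast; ring

lemma rc_half' (c y : ℝ) :
    1 - ((c : ℂ) + y * I) / 2 = ((1 - c / 2 : ℝ) : ℂ) + ((-(y / 2) : ℝ) : ℂ) * I := by
  push_cast; ring

lemma rc_Gamma_cont {σ : ℝ} (hσ : 0 < σ) {g : ℝ → ℝ} (hg : Continuous g) :
    Continuous (fun y : ℝ => Complex.Gamma ((σ : ℂ) + (g y : ℂ) * I)) := by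
  refine continuous_iff_continuousAt.2 fun y => ?_
  have h1 : ContinuousAt Complex.Gamma ((σ : ℂ) + (g y : ℂ) * I) := by
    refine (Complex.differentiableAt_Gamma _ fun m h => ?_).continuousAt
    have := congrArg Complex.re h
    simp at this
    have h2 : (0:ℝ) ≤ m := Nat.cast_nonneg m
    linarith
  have h2 : ContinuousAt (fun y : ℝ => (σ : ℂ) + (g y : ℂ) * I) y := by fun_prop
  exact ContinuousAt.comp (f := fun y : ℝ => (σ : ℂ) + (g y : ℂ) * I) h1 h2

lemma rcK_cont {u : ℂ} (hu : u ≠ 0) {c : ℝ} (hc0 : 0 < c) (hc2 : c < 2) : Continuous (rcK u c) := by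
  unfold rcK
  simp only [rc_half']
  simp only [rc_half]
  refine Continuous.mul (continuous_const.mul (Continuous.mul ?_ ?_)) ?_
  · exact rc_Gamma_cont (by positivity) (by fun_prop)
  · exact rc_Gamma_cont (by linarith) (by fun_prop)
  · exact Continuous.const_cpow (by fun_prop) (Or.inl hu)

lemma rcK_bound {u : ℂ} (hu : u ≠ 0) {c θ : ℝ} (hc0 : 0 < c) (hc2 : c < 2) (hθ0 : 0 ≤ θ)
    (hθ : θ < π / 2) :
    ∃ C : ℝ, 0 ≤ C ∧ ∀ y : ℝ, ‖rcK u c y‖ ≤ C * Real.exp (-((θ - |u.arg|) * |y|)) := by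
  obtain ⟨C1, h10, h1⟩ := rc_gamma_bound (σ := c / 2) (by positivity) hθ0 hθ
  obtain ⟨C2, h20, h2⟩ := rc_gamma_bound (σ := 1 - c / 2) (by linarith) hθ0 hθ
  refine ⟨1 / 2 * (C1 * C2) * ‖u‖ ^ (-c), by positivity, fun y => ?_⟩
  have g1 := h1 (y / 2)
  have g2 := h2 (-(y / 2))
  have g3 := rc_cpow_bound hu le_rfl (-((c : ℂ) + y * I))
  have e1 : |y / 2| = |y| / 2 := by rw [abs_div]; norm_num
  rw [e1] at g1
  rw [abs_neg, e1] at g2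
  rw [← rc_half] at g1
  rw [← rc_half'] at g2
  simp only [neg_re, add_re, ofReal_re, mul_re, I_re, mul_zero, ofReal_im, I_im, mul_one, sub_zero,
    add_zero, neg_im, add_im, mul_im, zero_add, abs_neg, sub_self, zero_mul] at g3
  unfold rcK
  rw [norm_mul, norm_mul, norm_mul]
  calc _ ≤ 1 / 2 * ((C1 * Real.exp (-(θ * (|y| / 2)))) * (C2 * Real.exp (-(θ * (|y| / 2)))))
        * (‖u‖ ^ (-c) * Real.exp (|u.arg| * |y|)) := by
        gcongr
        norm_num
    _ = 1 / 2 * (C1 * C2) * ‖u‖ ^ (-c) * (Real.exp (-(θ * (|y| / 2))) * Real.exp (-(θ * (|y| / 2)))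
        * Real.exp (|u.arg| * |y|)) := by ring
    _ = _ := by
        rw [← Real.exp_add, ← Real.exp_add]
        congr 2
        ring

lemma rcK_integrable {u : ℂ} (hu : 0 < u.re) {c : ℝ} (hc0 : 0 < c) (hc2 : c < 2) :
    Integrable (rcK u c) := by
  have hu0 : u ≠ 0 := by rintro rfl; simp at hu
  have harg : |u.arg| < π / 2 := Complex.abs_arg_lt_pi_div_two_iff.2 (Or.inl hu)
  obtain ⟨θ, h1, h2⟩ := exists_between harg
  obtain ⟨C, hC0, hC⟩ := rcK_bound hu0 hc0 hc2 ((abs_nonneg _).trans h1.le) h2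
  exact ((rc_exp_abs (sub_pos.2 h1)).const_mul C).mono' (rcK_cont hu0 hc0 hc2).aestronglyMeasurable
    (Eventually.of_forall hC)

lemma rc_den {u : ℂ} (hu : 0 < u.re) (t : ℝ) : u ^ 2 + (t:ℂ) ^ 2 ≠ 0 := by
  have e : u ^ 2 + (t:ℂ) ^ 2 = (u - t * I) * (u + t * I) := by
    linear_combination ((t:ℂ) ^ 2) * Complex.I_sq
  rw [e]
  refine mul_ne_zero (fun h => ?_) (fun h => ?_) <;>
  · have := congrArg Complex.re h
    simp at this
    linarith

lemma rc_bdd {u : ℂ} (hu : 0 < u.re) (t : ℝ) : ‖(t:ℂ) / (u ^ 2 + (t:ℂ) ^ 2)‖ ≤ 1 / u.re := by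
  have h1 : u.re ≤ ‖u - t * I‖ := by
    have := Complex.re_le_norm (u - t * I)
    simpa using this
  have h2 : u.re ≤ ‖u + t * I‖ := by
    have := Complex.re_le_norm (u + t * I)
    simpa using this
  have n1 : u - t * I ≠ 0 := norm_pos_iff.1 (hu.trans_le h1)
  have n2 : u + t * I ≠ 0 := norm_pos_iff.1 (hu.trans_le h2)
  have e : (t:ℂ) / (u ^ 2 + (t:ℂ) ^ 2) = (-I / 2) * (1 / (u - t * I) - 1 / (u + t * I)) := by
    have e : u ^ 2 + (t:ℂ) ^ 2 = (u - t * I) * (u + t * I) := by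
      linear_combination ((t:ℂ) ^ 2) * Complex.I_sq
    rw [e, div_sub_div _ _ n1 n2, mul_div_assoc', ]
    congr 1
    linear_combination (t:ℂ) * Complex.I_sq
  rw [e, norm_mul]
  have h3 : ‖1 / (u - t * I) - 1 / (u + t * I)‖ ≤ 1 / u.re + 1 / u.re := by
    refine (norm_sub_le _ _).trans ?_
    rw [norm_div, norm_div, norm_one]
    gcongr
  have h4 : ‖-I / 2‖ = 1 / 2 := by simp
  rw [h4]
  linarith

lemma rc_inv {u : ℂ} (hu : 0 < u.re) {c : ℝ} (hc0 : 0 < c) (hc2 : c < 2) {t : ℝ} (ht : 0 < t) :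
    (t:ℂ) / (u ^ 2 + (t:ℂ) ^ 2) =
      1 / (2 * π) * ∫ y : ℝ, (t : ℂ) ^ ((c : ℂ) + y * I - 1) * rcK u c y := by
  have ht' : (t:ℂ) ≠ 0 := by exact_mod_cast ht.ne'
  have hm : ∀ y : ℝ, mellin (fun x : ℝ => 1 / (1 + (x : ℂ) ^ 2 * u ^ 2)) ((c:ℂ) + y * I)
      = rcK u c y := fun y => (rc_mellin hu (by simpa using hc0) (by simpa using hc2)).2
  have hden := rc_den hu t
  have hden2 : 1 + ((t⁻¹ : ℝ) : ℂ) ^ 2 * u ^ 2 ≠ 0 := by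
    intro h
    apply hden
    push_cast at h
    field_simp at h
    linear_combination h
  have h := mellinInv_mellin_eq c (fun x : ℝ => 1 / (1 + (x : ℂ) ^ 2 * u ^ 2)) (x := t⁻¹)
    (by positivity) (rc_mellin (s := (c:ℂ)) hu (by simpa using hc0) (by simpa using hc2)).1 ?_ ?_
  · rw [mellinInv] at h
    simp only [hm, smul_eq_mul] at h
    have e : ∀ y : ℝ, (t : ℂ) ^ ((c : ℂ) + y * I - 1) * rcK u c y =
        (t:ℂ)⁻¹ * (((t⁻¹ : ℝ) : ℂ) ^ (-((c:ℂ) + y * I)) * rcK u c y) := by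
      intro y
      have : ((t⁻¹ : ℝ) : ℂ) ^ (-((c:ℂ) + y * I)) = (t:ℂ) ^ ((c:ℂ) + y * I) := by
        push_cast
        rw [Complex.inv_cpow, ← Complex.cpow_neg, neg_neg]
        rw [Complex.arg_ofReal_of_nonneg ht.le]; exact Real.pi_pos.ne
      rw [this, Complex.cpow_sub _ _ ht', Complex.cpow_one]
      field_simp
    simp only [e]
    rw [integral_const_mul, mul_left_comm]
    rw [Complex.real_smul] at h
    push_cast at h ⊢
    have e5 : 1 + (t:ℂ)⁻¹ ^ 2 * u ^ 2 = (u ^ 2 + (t:ℂ) ^ 2) / (t:ℂ) ^ 2 := by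
      field_simp
      ring
    rw [h, e5]
    field_simp
  · unfold Complex.VerticalIntegrable
    simp only [hm]
    exact rcK_integrable hu hc0 hc2
  · refine ContinuousAt.div continuousAt_const (by fun_prop) hden2

lemma rc_J {u : ℂ} (hu : 0 < u.re) {c : ℝ} (hc0 : 0 < c) (hc2 : c < 2) {r : ℂ} (hr : 0 < r.re) :
    ∫ t in Set.Ioi (0:ℝ), Complex.exp (-(r * t)) * ((t:ℂ) / (u ^ 2 + (t:ℂ) ^ 2)) =
      1 / (2 * π) * ∫ y : ℝ, (1 / r) ^ ((c : ℂ) + y * I) * Complex.Gamma ((c : ℂ) + y * I) * rcK u c y := by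
  have hu0 : u ≠ 0 := by rintro rfl; simp at hu
  set F : ℝ → ℝ → ℂ := fun t y =>
    (t : ℂ) ^ ((c : ℂ) + y * I - 1) * Complex.exp (-(r * t)) * rcK u c y with hF
  have hint : Integrable (Function.uncurry F) ((volume.restrict (Set.Ioi (0:ℝ))).prod volume) := by
    have hb : Integrable (fun z : ℝ × ℝ => z.1 ^ (c - 1) * Real.exp (-(r.re * z.1)) * ‖rcK u c z.2‖)
        ((volume.restrict (Set.Ioi (0:ℝ))).prod volume) :=
      Integrable.mul_prod (f := fun t : ℝ => t ^ (c - 1) * Real.exp (-(r.re * t)))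
        (g := fun y => ‖rcK u c y‖) (rc_int_rpow_exp hc0 hr) (rcK_integrable hu hc0 hc2).norm
    have hprod : (volume.restrict (Set.Ioi (0:ℝ))).prod (volume : Measure ℝ)
        = (volume.prod volume).restrict (Set.Ioi (0:ℝ) ×ˢ Set.univ) := by
      rw [← Measure.prod_restrict, Measure.restrict_univ]
    refine hb.mono' ?_ ?_
    · rw [hprod]
      refine ContinuousOn.aestronglyMeasurable ?_ (measurableSet_Ioi.prod MeasurableSet.univ)
      simp only [Function.uncurry_def, hF]
      refine ContinuousOn.mul (ContinuousOn.mul ?_ (by fun_prop)) ?_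
      · refine ContinuousOn.cpow (by fun_prop) (by fun_prop) fun x hx => ?_
        exact Or.inl (by simpa using hx.1)
      · exact ((rcK_cont hu0 hc0 hc2).comp continuous_snd).continuousOn
    · rw [hprod]
      filter_upwards [ae_restrict_mem (measurableSet_Ioi.prod MeasurableSet.univ)] with z hz
      simp only [Function.uncurry_def, hF]
      rw [norm_mul, rc_norm_integrand _ _ hz.1]
      simp
  have h1 : ∀ t ∈ Set.Ioi (0:ℝ), Complex.exp (-(r * t)) * ((t:ℂ) / (u ^ 2 + (t:ℂ) ^ 2)) =
      1 / (2 * π) * ∫ y : ℝ, F t y := by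
    intro t ht
    rw [rc_inv hu hc0 hc2 ht, mul_left_comm, ← integral_const_mul]
    congr 2
    funext y
    simp only [hF]; ring
  rw [setIntegral_congr_fun measurableSet_Ioi h1, integral_const_mul, integral_integral_swap hint]
  congr 2
  funext y
  simp only [hF]
  rw [integral_mul_const, rc_laplace (by simpa using hc0) hr]

lemma rc_gammaK {u : ℂ} (hu : 0 < u.re) {c : ℝ} (hc0 : 0 < c) (hc2 : c < 2) :
    Integrable (fun y : ℝ => Real.exp (π / 2 * |y|) *
      ‖Complex.Gamma ((c : ℂ) + y * I) * rcK u c y‖) := by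
  have hu0 : u ≠ 0 := by rintro rfl; simp at hu
  have harg : |u.arg| < π / 2 := Complex.abs_arg_lt_pi_div_two_iff.2 (Or.inl hu)
  obtain ⟨θ, h1, h2⟩ := exists_between (show (π / 2 + |u.arg|) / 2 < π / 2 by linarith)
  have hθ0 : 0 ≤ θ := by linarith [abs_nonneg u.arg, Real.pi_pos]
  obtain ⟨C, hC0, hC⟩ := rcK_bound hu0 hc0 hc2 hθ0 h2
  obtain ⟨D, hD0, hD⟩ := rc_gamma_bound hc0 hθ0 h2
  have hk : 0 < 2 * θ - π / 2 - |u.arg| := by linarith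
  refine ((rc_exp_abs hk).const_mul (D * C)).mono' ?_ (Eventually.of_forall fun y => ?_)
  · have := rc_Gamma_cont hc0 continuous_id
    have h3 := rcK_cont hu0 hc0 hc2
    exact (Continuous.mul (by fun_prop) (this.mul h3).norm).aestronglyMeasurable
  · rw [Real.norm_of_nonneg (by positivity), norm_mul]
    calc _ ≤ Real.exp (π / 2 * |y|) * ((D * Real.exp (-(θ * |y|))) *
          (C * Real.exp (-((θ - |u.arg|) * |y|)))) := by
          gcongr
          · exact hD y
          · exact hC y
      _ = D * C * (Real.exp (π / 2 * |y|) * Real.exp (-(θ * |y|)) *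
            Real.exp (-((θ - |u.arg|) * |y|))) := by ring
      _ = _ := by
          rw [← Real.exp_add, ← Real.exp_add]
          congr 2
          ring

lemma rc_dom {u : ℂ} {c : ℝ} {q : ℂ} (hc0 : 0 < c) (hq0 : q ≠ 0)
    (hq : 0 ≤ q.re) (hq1 : ‖q‖ ≤ 1) (y : ℝ) :
    ‖q ^ ((c : ℂ) + y * I) * Complex.Gamma ((c : ℂ) + y * I) * rcK u c y‖ ≤
      Real.exp (π / 2 * |y|) * ‖Complex.Gamma ((c : ℂ) + y * I) * rcK u c y‖ := by
  rw [mul_assoc, norm_mul]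
  gcongr
  have h := rc_cpow_bound hq0 (Complex.abs_arg_le_pi_div_two_iff.2 hq) ((c : ℂ) + y * I)
  simp only [add_re, ofReal_re, mul_re, I_re, mul_zero, ofReal_im, I_im, mul_one, sub_zero,
    add_zero, add_im, mul_im, zero_add, sub_self, zero_mul] at h
  refine h.trans ?_
  have : ‖q‖ ^ c ≤ 1 := Real.rpow_le_one (norm_nonneg _) hq1 hc0.le
  exact mul_le_of_le_one_left (Real.exp_pos _).le this

lemma rc_meas {u : ℂ} (hu : 0 < u.re) {c : ℝ} (hc0 : 0 < c) (hc2 : c < 2) {q : ℂ} (hq0 : q ≠ 0) :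
    AEStronglyMeasurable (fun y : ℝ =>
      q ^ ((c : ℂ) + y * I) * Complex.Gamma ((c : ℂ) + y * I) * rcK u c y) := by
  have hu0 : u ≠ 0 := by rintro rfl; simp at hu
  have h1 := rc_Gamma_cont hc0 continuous_id
  have h3 := rcK_cont hu0 hc0 hc2
  have h2 : Continuous (fun y : ℝ => q ^ ((c : ℂ) + y * I)) :=
    Continuous.const_cpow (by fun_prop) (Or.inl hq0)
  exact ((h2.mul h1).mul h3).aestronglyMeasurable

lemma rc_lim {u : ℂ} (hu : 0 < u.re) {c : ℝ} (hc0 : 0 < c) (hc2 : c < 2) {k : ℝ} (hk : |k| = 1) :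
    Tendsto (fun n : ℕ => ∫ t in Set.Ioi (0:ℝ),
      Complex.exp (-((((1 / ((n:ℝ) + 1) : ℝ) : ℂ) + k * I) * t)) * ((t:ℂ) / (u ^ 2 + (t:ℂ) ^ 2)))
      atTop (nhds (1 / (2 * π) * ∫ y : ℝ, (1 / ((k:ℂ) * I)) ^ ((c : ℂ) + y * I) *
        Complex.Gamma ((c : ℂ) + y * I) * rcK u c y)) := by
  have hk0 : k ≠ 0 := by rintro rfl; simp at hk
  have hre : ∀ n : ℕ, 0 < (((1 / ((n:ℝ) + 1) : ℝ) : ℂ) + k * I).re := by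
    intro n
    rw [Complex.add_re, Complex.ofReal_re, Complex.re_ofReal_mul, Complex.I_re, mul_zero, add_zero]
    positivity
  simp only [fun n : ℕ => rc_J hu hc0 hc2 (hre n)]
  refine Tendsto.const_mul _ ?_
  have hne : ∀ n : ℕ, (((1 / ((n:ℝ) + 1) : ℝ) : ℂ) + k * I) ≠ 0 := by
    intro n h
    have := hre n
    rw [h] at this
    simp at this
  have hkI : (k:ℂ) * I ≠ 0 := mul_ne_zero (by exact_mod_cast hk0) Complex.I_ne_zero
  refine tendsto_integral_of_dominated_convergence _ (fun n => ?_) (rc_gammaK hu hc0 hc2)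
    (fun n => Eventually.of_forall fun y => ?_) (Eventually.of_forall fun y => ?_)
  · exact rc_meas hu hc0 hc2 (one_div_ne_zero (hne n))
  · refine rc_dom hc0 (one_div_ne_zero (hne n)) ?_ ?_ y
    · rw [one_div, Complex.inv_re]
      exact div_nonneg (hre n).le (Complex.normSq_nonneg _)
    · rw [norm_div, norm_one]
      have h : 1 ≤ ‖(((1 / ((n:ℝ) + 1) : ℝ) : ℂ) + k * I)‖ := by
        have := Complex.abs_im_le_norm (((1 / ((n:ℝ) + 1) : ℝ) : ℂ) + k * I)
        rw [Complex.add_im, Complex.ofReal_im, Complex.im_ofReal_mul, Complex.I_im, mul_one,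
          zero_add, hk] at this
        exact this
      exact (div_le_one (by linarith)).2 h
  · refine Tendsto.mul_const _ (Tendsto.mul_const _ ?_)
    have hq : Tendsto (fun n : ℕ => 1 / (((1 / ((n:ℝ) + 1) : ℝ) : ℂ) + k * I)) atTop
        (nhds (1 / ((k:ℂ) * I))) := by
      refine Tendsto.div tendsto_const_nhds ?_ hkI
      have := (continuous_ofReal.tendsto _).comp (tendsto_one_div_add_atTop_nhds_zero_nat (𝕜 := ℝ))
      have := this.add_const ((k:ℂ) * I)
      simpa [Function.comp_def] using this
    refine ((continuousAt_cpow_const ?_).tendsto).comp hq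
    right
    rw [one_div, Complex.inv_im]
    refine div_ne_zero ?_ (Complex.normSq_pos.2 hkI).ne'
    simpa using hk0

theorem mellin_cot_raabe (u : ℂ) (hu : 0 < u.re) (c₁ : ℝ) (hc₁ : 0 < c₁) (hc₂ : c₁ < 2)
    (R : ℂ)
    (hR : Filter.Tendsto
      (fun T : ℝ => ∫ t in (0 : ℝ)..T, (t : ℂ) * Real.cos t / (u ^ 2 + (t : ℂ) ^ 2))
      Filter.atTop (nhds R)) :
    (1 / (2 * (π : ℂ) * Complex.I)) *
      ∫ t : ℝ, (Complex.Gamma ((c₁ : ℂ) + t * Complex.I) /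
        Complex.tan ((π : ℂ) * ((c₁ : ℂ) + t * Complex.I) / 2)) *
          u ^ (-((c₁ : ℂ) + t * Complex.I)) * Complex.I =
      (2 / (π : ℂ)) * R := by
  have hcont : Continuous (fun t : ℝ => (t:ℂ) / (u ^ 2 + (t:ℂ) ^ 2)) :=
    Continuous.div (by fun_prop) (by fun_prop) (rc_den hu)
  have hπ : (π : ℂ) ≠ 0 := by exact_mod_cast Real.pi_ne_zero
  -- Abel summation of the Raabe integral
  have hA := rc_abel (f := fun t : ℝ => (t : ℂ) * Real.cos t / (u ^ 2 + (t : ℂ) ^ 2)) (R := R)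
    (M := 1 / u.re) (Continuous.div (by fun_prop) (by fun_prop) (rc_den hu)) (fun t => by
      rw [mul_div_right_comm, norm_mul]
      refine (mul_le_of_le_one_right (norm_nonneg _) ?_).trans (rc_bdd hu t)
      rw [Complex.norm_real]
      exact Real.abs_cos_le_one t) hR
  have hint : ∀ r : ℂ, 0 < r.re → IntegrableOn
      (fun t : ℝ => Complex.exp (-(r * t)) * ((t:ℂ) / (u ^ 2 + (t:ℂ) ^ 2))) (Set.Ioi 0) := by
    intro r hr
    have h1 : IntegrableOn (fun t : ℝ => Complex.exp (-(r * t))) (Set.Ioi 0) := by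
      have := integrableOn_exp_mul_complex_Ioi (a := -r) (by simpa using hr) 0
      simpa using this
    exact h1.mul_bdd (c := 1 / u.re) hcont.aestronglyMeasurable.restrict
      (Eventually.of_forall (rc_bdd hu))
  have hB := ((rc_lim hu hc₁ hc₂ (k := 1) (by simp)).add
    (rc_lim hu hc₁ hc₂ (k := -1) (by simp))).const_mul (1 / 2 : ℂ)
  have hAB : R = _ := tendsto_nhds_unique hA (hB.congr fun n => by
    have hε : (0:ℝ) < 1 / ((n:ℝ) + 1) := by positivity
    generalize (1 / ((n:ℝ) + 1)) = ε at hε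
    rw [← integral_add (hint _ (by simpa using hε)) (hint _ (by simpa using hε)),
      ← integral_const_mul]
    congr 1
    funext t
    have e1 : Complex.exp (-(((ε : ℂ) + ((1:ℝ):ℂ) * I) * t)) =
        Complex.exp (-(ε * t)) * Complex.exp (-t * I) := by
      rw [← Complex.exp_add]; congr 1; push_cast; ring
    have e2 : Complex.exp (-(((ε : ℂ) + ((-1:ℝ):ℂ) * I) * t)) =
        Complex.exp (-(ε * t)) * Complex.exp (t * I) := by
      rw [← Complex.exp_add]; congr 1; push_cast; ring
    rw [e1, e2, Complex.ofReal_cos, Complex.cos]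
    ring)
  have hne1 : ∀ k : ℝ, |k| = 1 → Integrable (fun y : ℝ => (1 / ((k:ℂ) * I)) ^ ((c₁ : ℂ) + y * I) *
        Complex.Gamma ((c₁ : ℂ) + y * I) * rcK u c₁ y) := by
    intro k hk
    have hk0 : k ≠ 0 := by rintro rfl; simp at hk
    have hkI : (k:ℂ) * I ≠ 0 := mul_ne_zero (by exact_mod_cast hk0) Complex.I_ne_zero
    refine (rc_gammaK hu hc₁ hc₂).mono' (rc_meas hu hc₁ hc₂ (one_div_ne_zero hkI))
      (Eventually.of_forall fun y => rc_dom hc₁ (one_div_ne_zero hkI) ?_ ?_ y)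
    · rw [one_div, Complex.inv_re]; simp
    · simp [hk]
  rw [← mul_add, ← integral_add (hne1 1 (by simp)) (hne1 (-1) (by simp))] at hAB
  have hfin : ∀ y : ℝ, (Complex.Gamma ((c₁ : ℂ) + y * Complex.I) /
        Complex.tan ((π : ℂ) * ((c₁ : ℂ) + y * Complex.I) / 2)) *
          u ^ (-((c₁ : ℂ) + y * Complex.I)) * Complex.I = (2 * I / π) * (1 / 2 * (
      (1 / (((1:ℝ):ℂ) * I)) ^ ((c₁ : ℂ) + y * I) * Complex.Gamma ((c₁ : ℂ) + y * I) * rcK u c₁ y +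
      (1 / (((-1:ℝ):ℂ) * I)) ^ ((c₁ : ℂ) + y * I) * Complex.Gamma ((c₁ : ℂ) + y * I) * rcK u c₁ y)) := by
    intro y
    generalize hs : (c₁ : ℂ) + y * I = s
    have i1 : 1 / (((1:ℝ):ℂ) * I) = -I := by simp
    have i2 : 1 / (((-1:ℝ):ℂ) * I) = I := by simp
    have hsum : (-I) ^ s + I ^ s = 2 * Complex.cos (π * s / 2) := by
      rw [Complex.cpow_def_of_ne_zero (by simp), Complex.cpow_def_of_ne_zero (by simp),
        Complex.log_I, Complex.log_neg_I, Complex.cos]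
      rw [show -(π / 2 : ℂ) * I * s = -(π * s / 2) * I by ring,
        show (π / 2 : ℂ) * I * s = (π * s / 2) * I by ring]
      ring
    have hK : rcK u c₁ y = 1 / 2 * (π / Complex.sin (π * s / 2)) * u ^ (-s) := by
      unfold rcK
      rw [hs, Complex.Gamma_mul_Gamma_one_sub, mul_div_assoc]
    rw [i1, i2, ← add_mul, ← add_mul, hsum, hK, Complex.tan_eq_sin_div_cos, div_div_eq_mul_div]
    have : (π : ℂ) * (1 / π) = 1 := by field_simp
    linear_combination (-(Complex.Gamma s * Complex.cos (π * s / 2) / Complex.sin (π * s / 2) * u ^ (-s) * I)) * this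
  simp only [hfin]
  rw [integral_const_mul, integral_const_mul, hAB]
  field_simp
end

section
/- For α, β > 0 with αβ = π², Σ_{n=1}^∞ 1/(n(e^{2nα} − 1)) − Σ_{n=1}^∞ 1/(n(e^{2nβ} − 1)) = (β − α)/12 + (1/4)·log(α/β). -/
open Real

lemma aux_summable_log {q : ℝ} (h0 : 0 < q) (h1 : q < 1) :
    Summable fun n : ℕ => Real.log (1 - q ^ (n + 1)) := by
  have h : Summable fun n : ℕ => -q ^ (n + 1) :=
    ((summable_nat_add_iff 1).mpr (summable_geometric_of_lt_one h0.le h1)).neg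
  simpa [sub_eq_add_neg] using Real.summable_log_one_add_of_summable h

/-- The Lambert series as a sum of logarithms. -/
lemma aux_tsum_log {α : ℝ} (hα : 0 < α) :
    ∑' n : ℕ, 1 / ((n + 1) * (Real.exp (2 * (n + 1) * α) - 1)) =
      -∑' n : ℕ, Real.log (1 - Real.exp (-(2 * α)) ^ (n + 1)) := by
  set q := Real.exp (-(2 * α)) with hq
  have h0 : 0 < q := Real.exp_pos _
  have h1 : q < 1 := by rw [hq, Real.exp_lt_one_iff]; linarith
  have hpow : ∀ n : ℕ, q ^ (n + 1) < 1 := fun n => pow_lt_one₀ h0.le h1 (by omega)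
  have hlog : ∀ n : ℕ, HasSum (fun m : ℕ => (q ^ (n + 1)) ^ (m + 1) / ((m : ℝ) + 1))
      (-Real.log (1 - q ^ (n + 1))) := fun n =>
    Real.hasSum_pow_div_log_of_abs_lt_one
      (by rw [abs_of_pos (pow_pos h0 _)]; exact hpow n)
  have hsum : Summable (Function.uncurry
      fun (n m : ℕ) => (q ^ (n + 1)) ^ (m + 1) / ((m : ℝ) + 1)) := by
    rw [summable_prod_of_nonneg]
    · refine ⟨fun n => (hlog n).summable, ?_⟩
      refine (aux_summable_log h0 h1).neg.congr fun n => ?_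
      exact (hlog n).tsum_eq.symm
    · intro p
      simp only [Function.uncurry, Pi.zero_apply]
      positivity
  have hcomm := hsum.tsum_comm
  rw [← tsum_neg, ← tsum_congr fun n => (hlog n).tsum_eq, ← hcomm]
  refine tsum_congr fun m => ?_
  have hg := ((hasSum_geometric_of_lt_one (pow_pos h0 (m + 1)).le (hpow m)).mul_left
    (q ^ (m + 1))).div_const ((m : ℝ) + 1)
  have e : ∀ n : ℕ, (q ^ (n + 1)) ^ (m + 1) / ((m : ℝ) + 1) =
      q ^ (m + 1) * (q ^ (m + 1)) ^ n / ((m : ℝ) + 1) := by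
    intro n
    rw [← pow_mul, ← pow_mul, ← pow_add]
    congr 2
    ring
  rw [tsum_congr e, hg.tsum_eq]
  have hE : Real.exp (2 * ((m : ℝ) + 1) * α) = (q ^ (m + 1))⁻¹ := by
    rw [hq, ← Real.exp_nat_mul, ← Real.exp_neg]
    congr 1
    push_cast
    ring
  rw [hE]
  have hr := hpow m
  have hr0 : 0 < q ^ (m + 1) := pow_pos h0 _
  generalize q ^ (m + 1) = r at hr hr0
  have : 1 - r ≠ 0 := by linarith
  have : (m : ℝ) + 1 ≠ 0 := by positivity
  have h2 : r⁻¹ - 1 = (1 - r) / r := by field_simp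
  rw [h2]
  field_simp

/-- The absolute value of the eta function on the imaginary axis. -/
lemma aux_norm_eta {α : ℝ} (hα : 0 < α) :
    Real.log ‖ModularForm.eta (((α / π : ℝ) : ℂ) * Complex.I)‖ =
      -α / 12 + ∑' n : ℕ, Real.log (1 - Real.exp (-(2 * α)) ^ (n + 1)) := by
  set z : ℂ := ((α / π : ℝ) : ℂ) * Complex.I with hz
  have hpi := Real.pi_pos
  have hpc : (π : ℂ) ≠ 0 := by exact_mod_cast hpi.ne'
  have h0 : 0 < Real.exp (-(2 * α)) := Real.exp_pos _
  have h1 : Real.exp (-(2 * α)) < 1 := by rw [Real.exp_lt_one_iff]; linarith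
  have hzm : z ∈ UpperHalfPlane.upperHalfPlaneSet := by
    change 0 < z.im
    simp [hz]
    positivity
  have hm := ModularForm.multipliableLocallyUniformlyOn_eta.multipliable hzm
  have hterm : ∀ n : ℕ, ‖1 - ModularForm.eta_q n z‖ = 1 - Real.exp (-(2 * α)) ^ (n + 1) := by
    intro n
    have : ModularForm.eta_q n z = ((Real.exp (-(2 * α)) ^ (n + 1) : ℝ) : ℂ) := by
      rw [ModularForm.eta_q_eq_pow]
      push_cast
      congr 2
      rw [hz]
      push_cast
      field_simp
      simp
    rw [this, ← Complex.ofReal_one, ← Complex.ofReal_sub, Complex.norm_real, Real.norm_eq_abs,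
      abs_of_pos]
    linarith [pow_lt_one₀ h0.le h1 (show n + 1 ≠ 0 by omega)]
  have hq : ‖Function.Periodic.qParam 24 z‖ = Real.exp (-α / 12) := by
    rw [Function.Periodic.norm_qParam]
    congr 1
    simp [hz]
    field_simp
    norm_num
  have hp : ∏' n : ℕ, (1 - Real.exp (-(2 * α)) ^ (n + 1)) =
      Real.exp (∑' n : ℕ, Real.log (1 - Real.exp (-(2 * α)) ^ (n + 1))) := by
    rw [Real.rexp_tsum_eq_tprod _ (aux_summable_log h0 h1)]
    intro n
    linarith [pow_lt_one₀ h0.le h1 (show n + 1 ≠ 0 by omega)]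
  rw [ModularForm.eta, norm_mul, hm.norm_tprod, tprod_congr hterm, hp, hq, ← Real.exp_add,
    Real.log_exp]

lemma aux_norm_sqrt {z : ℂ} (hz : z ≠ 0) : ‖Complex.sqrt z‖ = ‖z‖ ^ (1 / 2 : ℝ) := by
  rw [Complex.sqrt, Complex.norm_cpow_of_ne_zero hz]
  norm_num

theorem log_eta_transformation (α β : ℝ) (hα : 0 < α) (hβ : 0 < β)
    (hab : α * β = π ^ 2) :
    (∑' n : ℕ, 1 / ((n + 1) * (Real.exp (2 * (n + 1) * α) - 1))) -
      (∑' n : ℕ, 1 / ((n + 1) * (Real.exp (2 * (n + 1) * β) - 1))) =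
      (β - α) / 12 + (1 / 4) * Real.log (α / β) := by
  have hpi := Real.pi_pos
  rw [aux_tsum_log hα, aux_tsum_log hβ]
  have ha := aux_norm_eta hα
  have hb := aux_norm_eta hβ
  set z : ℂ := ((α / π : ℝ) : ℂ) * Complex.I with hz
  have hzm : z ∈ UpperHalfPlane.upperHalfPlaneSet := by
    change 0 < z.im
    simp [hz]
    positivity
  have hz0 : z ≠ 0 := by
    intro h
    rw [h] at hzm
    exact lt_irrefl (0 : ℝ) hzm
  have hnz : ‖z‖ = α / π := by
    rw [hz, norm_mul, Complex.norm_I, mul_one, Complex.norm_real, Real.norm_eq_abs,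
      abs_of_pos (by positivity)]
  have hS : ((β / π : ℝ) : ℂ) * Complex.I = -1 / z := by
    rw [eq_div_iff hz0, hz]
    have : ((β / π : ℝ) : ℂ) * ((α / π : ℝ) : ℂ) = 1 := by
      rw [← Complex.ofReal_mul, ← Complex.ofReal_one]
      congr 1
      field_simp
      linarith
    linear_combination (-1 : ℂ) * this + ((β / π : ℝ) : ℂ) * ((α / π : ℝ) : ℂ) * Complex.I_sq
  have key : ‖ModularForm.eta (-1 / z)‖ = (α / π) ^ (1 / 2 : ℝ) * ‖ModularForm.eta z‖ := by
    have h := congrArg norm (ModularForm.eta_comp_eq_csqrt_I_inv hzm)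
    simp only [Function.comp, Pi.smul_apply, Pi.mul_apply, smul_eq_mul, norm_mul, norm_inv] at h
    rw [aux_norm_sqrt hz0, aux_norm_sqrt Complex.I_ne_zero, hnz, Complex.norm_I] at h
    simpa using h
  rw [hS, key, Real.log_mul (by positivity)
    (norm_ne_zero_iff.mpr (ModularForm.eta_ne_zero hzm)), Real.log_rpow (by positivity)] at hb
  have hlog : Real.log (α / β) = 2 * Real.log (α / π) := by
    have : α / β = (α / π) ^ 2 := by
      field_simp
      nlinarith
    rw [this, Real.log_pow]
    norm_num
  rw [hlog]
  linarith
end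

section
/- For α, β > 0 with αβ = π², Σ_{n=1}^∞ e^{nα}/(n(e^{2nα} − 1)) − Σ_{n=1}^∞ (−1)ⁿ/(n(e^{2nβ} − 1)) = −(1/2)·log 2 + (α + 2β)/24. -/
open Real

set_option maxHeartbeats 2000000 in
lemma L_aux (x : ℝ) (hx : 0 < x) : ∃ T : ℝ,
    HasSum (fun n : ℕ => 1 / (((n : ℝ) + 1) * (Real.exp ((n + 1) * x) - 1))) T ∧
    HasSum (fun k : ℕ => Real.log (1 - Real.exp (-x) ^ (k + 1))) (-T) := by
  have hq : Real.exp (-x) < 1 := by simpa using hx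
  have hq0 : 0 < Real.exp (-x) := Real.exp_pos _
  let F : ℕ × ℕ → ℝ := fun p => (Real.exp (-x) ^ (p.2 + 1)) ^ (p.1 + 1) / ((p.1 : ℝ) + 1)
  have hF0 : 0 ≤ F := fun p => by simp only [F, Pi.zero_apply]; positivity
  have hrow : ∀ n : ℕ, HasSum (fun k => F (n, k))
      (1 / (((n : ℝ) + 1) * (Real.exp ((n + 1) * x) - 1))) := by
    intro n
    have hr1 : Real.exp (-x) ^ (n + 1) < 1 := pow_lt_one₀ hq0.le hq (by simp)
    have hr0 : 0 < Real.exp (-x) ^ (n + 1) := by positivity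
    have h := (hasSum_geometric_of_lt_one hr0.le hr1).mul_left
      (Real.exp (-x) ^ (n + 1) / ((n : ℝ) + 1))
    have he : Real.exp ((n + 1) * x) = (Real.exp (-x) ^ (n + 1))⁻¹ := by
      rw [← Real.exp_nat_mul, ← Real.exp_neg]; congr 1; push_cast; ring
    rw [he]
    convert! h using 1
    · funext k
      simp only [F]
      rw [← pow_mul, ← pow_mul, div_mul_eq_mul_div, ← pow_add]
      congr 2; ring
    · have : 1 - Real.exp (-x) ^ (n + 1) ≠ 0 := by linarith
      have h3 : (Real.exp (-x) ^ (n + 1))⁻¹ - 1 ≠ 0 := by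
        have := (one_lt_inv₀ hr0).2 hr1
        linarith
      generalize Real.exp (-x) ^ (n + 1) = r at *
      have h4 : r⁻¹ - 1 = (1 - r) / r := by field_simp
      rw [h4]
      field_simp
  have hcol : ∀ k : ℕ, HasSum (fun n => F (n, k)) (-Real.log (1 - Real.exp (-x) ^ (k + 1))) := by
    intro k
    have hk : |Real.exp (-x) ^ (k + 1)| < 1 := by
      rw [abs_of_pos (by positivity)]
      exact pow_lt_one₀ hq0.le hq (by simp)
    exact Real.hasSum_pow_div_log_of_abs_lt_one hk
  have hS : Summable F := by
    rw [summable_prod_of_nonneg hF0]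
    refine ⟨fun n => (hrow n).summable, ?_⟩
    simp_rw [fun n => (hrow n).tsum_eq]
    have hb : Summable (fun n : ℕ => x⁻¹ * (1 / ((n + 1 : ℕ) : ℝ) ^ 2)) :=
      ((summable_nat_add_iff 1).2
        (Real.summable_one_div_nat_pow.2 (by norm_num : 1 < 2))).mul_left _
    refine hb.of_nonneg_of_le (fun n => (hrow n).nonneg fun k => hF0 _) fun n => ?_
    have h1 : ((n : ℝ) + 1) * x ≤ Real.exp ((n + 1) * x) - 1 := by
      linarith [Real.add_one_le_exp (((n : ℝ) + 1) * x)]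
    have h2 : x⁻¹ * (1 / ((n + 1 : ℕ) : ℝ) ^ 2) = 1 / (((n : ℝ) + 1) * (((n : ℝ) + 1) * x)) := by
      push_cast; field_simp
    rw [h2]
    gcongr
  refine ⟨∑' p, F p, hS.hasSum.prod_fiberwise hrow, ?_⟩
  have h := ((Equiv.prodComm ℕ ℕ).hasSum_iff.2 hS.hasSum).prod_fiberwise hcol
  simpa using h.neg

lemma eta_val (x T : ℝ) (hx : 0 < x)
    (h : HasSum (fun k : ℕ => Real.log (1 - Real.exp (-x) ^ (k + 1))) (-T)) :
    ModularForm.eta (Complex.I * ((x / (2 * π) : ℝ) : ℂ)) = ((Real.exp (-x / 24 - T) : ℝ) : ℂ) := by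
  have hq : Real.exp (-x) < 1 := by simpa using hx
  have hp := Real.hasProd_of_hasSum_log
    (fun k : ℕ => sub_pos.2 (pow_lt_one₀ (Real.exp_pos (-x)).le hq (Nat.succ_ne_zero k))) h
  have hpc := hp.map Complex.ofRealHom Complex.continuous_ofReal
  have hpi : (π : ℂ) ≠ 0 := by exact_mod_cast Real.pi_ne_zero
  have hterm : (fun n : ℕ => 1 - ModularForm.eta_q n (Complex.I * ((x / (2 * π) : ℝ) : ℂ)))
      = Complex.ofRealHom ∘ (fun k : ℕ => 1 - Real.exp (-x) ^ (k + 1)) := by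
    funext n
    simp only [ModularForm.eta_q_eq_pow, Function.comp, Complex.ofRealHom_eq_coe]
    push_cast
    congr 3
    field_simp
    simp
  rw [ModularForm.eta, hterm, hpc.tprod_eq, sub_eq_add_neg, Real.exp_add]
  simp only [Function.Periodic.qParam, Complex.ofRealHom_eq_coe]
  push_cast
  congr 2
  field_simp
  simp

lemma eta_trans (x y T U : ℝ) (hx : 0 < x) (hy : 0 < y) (hxy : x * y = 4 * π ^ 2)
    (hT : HasSum (fun k : ℕ => Real.log (1 - Real.exp (-x) ^ (k + 1))) (-T))
    (hU : HasSum (fun k : ℕ => Real.log (1 - Real.exp (-y) ^ (k + 1))) (-U)) :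
    -y / 24 - U = 1 / 2 * Real.log (x / (2 * π)) + (-x / 24 - T) := by
  have hpi : (π : ℝ) ≠ 0 := Real.pi_ne_zero
  have hpos : 0 < x / (2 * π) := by positivity
  have key := ModularForm.eta_comp_eq_csqrt_I_inv
    (show Complex.I * ((x / (2 * π) : ℝ) : ℂ) ∈ UpperHalfPlane.upperHalfPlaneSet by
      change 0 < (Complex.I * ((x / (2 * π) : ℝ) : ℂ)).im
      rw [Complex.I_mul_im, Complex.ofReal_re]
      exact hpos)
  have hinv : -1 / (Complex.I * ((x / (2 * π) : ℝ) : ℂ)) = Complex.I * ((y / (2 * π) : ℝ) : ℂ) := by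
    have : y / (2 * π) = (x / (2 * π))⁻¹ := by field_simp; linarith
    rw [this]
    have h0 : ((x / (2 * π) : ℝ) : ℂ) ≠ 0 := by exact_mod_cast hpos.ne'
    rw [Complex.ofReal_inv]
    field_simp
    simp
  simp only [Function.comp, Pi.smul_apply, Pi.mul_apply, smul_eq_mul, hinv] at key
  rw [eta_val x T hx hT, eta_val y U hy hU] at key
  have hs : ∀ z : ℂ, ‖Complex.sqrt z‖ ^ 2 = ‖z‖ := by
    intro z
    rw [← norm_pow]
    simp [Complex.sqrt, ← Complex.cpow_nat_mul]
  have k2 := congrArg (fun z => ‖z‖ ^ 2) key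
  simp only [norm_mul, norm_inv, mul_pow, inv_pow, hs, Complex.norm_I, Complex.norm_real,
    Real.norm_eq_abs, Real.abs_exp, abs_of_pos hpos] at k2
  have k3 := congrArg Real.log k2
  rw [inv_one, one_mul, one_mul, Real.log_mul hpos.ne' (by positivity), Real.log_pow, Real.log_pow,
    Real.log_exp, Real.log_exp] at k3
  push_cast at k3
  linarith

theorem eta_analogue (α β : ℝ) (hα : 0 < α) (hβ : 0 < β) (hab : α * β = π ^ 2) :
    (∑' n : ℕ, Real.exp ((n + 1) * α) / ((n + 1) * (Real.exp (2 * (n + 1) * α) - 1))) -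
      (∑' n : ℕ, (-1 : ℝ) ^ (n + 1) / ((n + 1) * (Real.exp (2 * (n + 1) * β) - 1))) =
      -(1 / 2) * Real.log 2 + (α + 2 * β) / 24 := by
  obtain ⟨A1, hA1, hA1'⟩ := L_aux α hα
  obtain ⟨A2, hA2, hA2'⟩ := L_aux (2 * α) (by positivity)
  obtain ⟨B2, hB2, hB2'⟩ := L_aux (2 * β) (by positivity)
  obtain ⟨B4, hB4, hB4'⟩ := L_aux (4 * β) (by positivity)
  have t1 := eta_trans α (4 * β) A1 B4 hα (by positivity) (by linarith) hA1' hB4'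
  have t2 := eta_trans (2 * α) (2 * β) A2 B2 (by positivity) (by positivity) (by linarith)
    hA2' hB2'
  have hlog : Real.log (2 * α / (2 * π)) = Real.log 2 + Real.log (α / (2 * π)) := by
    rw [mul_div_assoc, Real.log_mul (by norm_num) (by positivity)]
  rw [hlog] at t2
  have s1 : HasSum (fun n : ℕ => Real.exp ((n + 1) * α) /
      (((n : ℝ) + 1) * (Real.exp (2 * (n + 1) * α) - 1))) (A1 - A2) := by
    convert! hA1.sub hA2 using 1
    funext n
    have h1 : Real.exp (2 * (n + 1) * α) = Real.exp ((n + 1) * α) ^ 2 := by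
      rw [← Real.exp_nat_mul]; congr 1; push_cast; ring
    have h2 : Real.exp ((n + 1) * (2 * α)) = Real.exp ((n + 1) * α) ^ 2 := by
      rw [← Real.exp_nat_mul]; congr 1; push_cast; ring
    have h3 : 1 < Real.exp (((n : ℝ) + 1) * α) := Real.one_lt_exp_iff.2 (by positivity)
    rw [h1, h2]
    generalize Real.exp (((n : ℝ) + 1) * α) = r at *
    have h4 : r - 1 ≠ 0 := by linarith
    have h5 : r + 1 ≠ 0 := by linarith
    have h6 : r ^ 2 - 1 = (r - 1) * (r + 1) := by ring
    rw [h6]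
    field_simp
    ring
  have s2 : HasSum (fun n : ℕ => (-1 : ℝ) ^ (n + 1) /
      (((n : ℝ) + 1) * (Real.exp (2 * (n + 1) * β) - 1))) (B4 - B2) := by
    -- the even-indexed part carries twice the weight
    have hev : HasSum (fun n : ℕ => (1 + (-1 : ℝ) ^ (n + 1)) /
        (((n : ℝ) + 1) * (Real.exp (2 * (n + 1) * β) - 1))) (0 + B4) := by
      apply HasSum.even_add_odd
      · convert hasSum_zero using 1
        funext k
        simp [pow_succ, pow_mul]
      · convert hB4 using 1
        funext k
        have : (2 : ℝ) * (((2 * k + 1 : ℕ) : ℝ) + 1) * β = (k + 1) * (4 * β) := by push_cast; ring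
        rw [this]
        have h1 : (-1 : ℝ) ^ (2 * k + 1 + 1) = 1 := by simp [pow_succ, pow_mul]
        rw [h1]
        have h3 : 1 < Real.exp (((k : ℝ) + 1) * (4 * β)) := Real.one_lt_exp_iff.2 (by positivity)
        have h4 : Real.exp (((k : ℝ) + 1) * (4 * β)) - 1 ≠ 0 := by linarith
        push_cast
        have h5 : (2 * (k : ℝ) + 1 + 1) = 2 * (k + 1) := by ring
        rw [h5]
        field_simp
        norm_num
    convert! hev.sub hB2 using 1
    · funext n
      have : ((n : ℝ) + 1) * (2 * β) = 2 * (n + 1) * β := by ring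
      rw [this, ← sub_div]
      congr 1
      ring
    · ring
  rw [s1.tsum_eq, s2.tsum_eq]
  linarith
end

section
/- √2 · e^{α/24} · ∏_{n=0}^∞ (1 − e^{−(2n+1)α}) = e^{−β/12} · ∏_{n=0}^∞ (1 + e^{−2nβ}), whenever α, β > 0 satisfy αβ = π². -/
open Real

/-- The Euler product `∏ (1 - e^{-(n+1)x})`. -/
noncomputable def eulerP (x : ℝ) : ℝ := ∏' n : ℕ, (1 - Real.exp (-((n : ℝ) + 1) * x))

/-- The eta function on the imaginary axis, `e^{-x/24} ∏ (1 - e^{-(n+1)x})`. -/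
noncomputable def etaR (x : ℝ) : ℝ := Real.exp (-x / 24) * eulerP x

lemma summable_exp_lin (a b : ℝ) (ha : 0 < a) :
    Summable fun n : ℕ => Real.exp (-(a * (n : ℝ) + b)) := by
  have h := (Real.summable_exp_nat_mul_iff (a := -a)).2 (by linarith)
  refine (h.mul_left (Real.exp (-b))).congr fun n => ?_
  rw [← Real.exp_add]
  congr 1
  ring

lemma mult_sub (a b : ℝ) (ha : 0 < a) :
    Multipliable fun n : ℕ => 1 - Real.exp (-(a * (n : ℝ) + b)) := by
  have := Real.multipliable_one_add_of_summable (summable_exp_lin a b ha).neg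
  simpa [sub_eq_add_neg] using this

lemma mult_add (a b : ℝ) (ha : 0 < a) :
    Multipliable fun n : ℕ => 1 + Real.exp (-(a * (n : ℝ) + b)) :=
  Real.multipliable_one_add_of_summable (summable_exp_lin a b ha)

lemma tprod_nonneg_aux (f : ℕ → ℝ) (hf : Multipliable f) (h0 : ∀ n, 0 ≤ f n) :
    0 ≤ ∏' n, f n :=
  ge_of_tendsto' hf.hasProd.tendsto_prod_nat fun _ => Finset.prod_nonneg fun i _ => h0 i

lemma mult_eulerP (x : ℝ) (hx : 0 < x) :
    Multipliable fun n : ℕ => 1 - Real.exp (-((n : ℝ) + 1) * x) := by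
  convert mult_sub x x hx using 4
  ring

lemma etaR_eq (x : ℝ) (hx : 0 < x) :
    ((etaR x : ℝ) : ℂ) = ModularForm.eta (Complex.I * (x / (2 * π) : ℝ)) := by
  have hpi : (π : ℂ) ≠ 0 := by exact_mod_cast Real.pi_ne_zero
  have hI := Complex.I_sq
  unfold etaR eulerP ModularForm.eta
  push_cast
  congr 1
  · rw [Function.Periodic.qParam]
    congr 1
    push_cast
    field_simp
    linear_combination (-(x : ℂ)) * hI
  · have h := (mult_eulerP x hx).map_tprod Complex.ofRealHom Complex.continuous_ofReal
    simp only [Complex.ofRealHom_eq_coe] at h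
    rw [h]
    refine tprod_congr fun n => ?_
    rw [ModularForm.eta_q_eq_cexp]
    push_cast
    congr 2
    field_simp
    linear_combination (-(x : ℂ)) * hI

lemma mem_up (x : ℝ) (hx : 0 < x) :
    (Complex.I * (x / (2 * π) : ℝ)) ∈ UpperHalfPlane.upperHalfPlaneSet := by
  have : 0 < x / (2 * π) := by positivity
  change 0 < (Complex.I * (x / (2 * π) : ℝ)).im
  rwa [Complex.I_mul_im, Complex.ofReal_re]

lemma etaR_ne (x : ℝ) (hx : 0 < x) : etaR x ≠ 0 := by
  have h := ModularForm.eta_ne_zero (mem_up x hx)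
  rw [← etaR_eq x hx] at h
  exact_mod_cast h

lemma csqrt_sq' (z : ℂ) : Complex.sqrt z ^ 2 = z := by
  simp [Complex.sqrt]

lemma etaR_sq (x y : ℝ) (hx : 0 < x) (hy : 0 < y) (hxy : x * y = 4 * π ^ 2) :
    etaR y ^ 2 = x / (2 * π) * etaR x ^ 2 := by
  have h := ModularForm.eta_comp_eq_csqrt_I_inv (mem_up x hx)
  have hpi : (π : ℂ) ≠ 0 := by exact_mod_cast Real.pi_ne_zero
  have hxc : (x : ℂ) ≠ 0 := by exact_mod_cast hx.ne'
  have hc : (x : ℂ) * y = 4 * π ^ 2 := by exact_mod_cast hxy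
  have hz : -1 / (Complex.I * (x / (2 * π) : ℝ)) = Complex.I * (y / (2 * π) : ℝ) := by
    have hI := Complex.I_sq
    have := Complex.I_ne_zero
    push_cast
    field_simp
    linear_combination (-(x : ℂ) * y) * hI + hc
  simp only [Function.comp, hz, Pi.smul_apply, Pi.mul_apply, smul_eq_mul] at h
  rw [← etaR_eq x hx, ← etaR_eq y hy] at h
  have h2 := congrArg (· ^ 2) h
  simp only [mul_pow, inv_pow, csqrt_sq'] at h2
  have h3 : ((etaR y : ℝ) : ℂ) ^ 2 = ((x / (2 * π) : ℝ) : ℂ) * (etaR x : ℂ) ^ 2 := by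
    rw [h2]
    have := Complex.I_ne_zero
    field_simp
  exact_mod_cast h3

lemma final_step (α β B C : ℝ) (hα : 0 < α) (hβ : 0 < β) (hab : α * β = π ^ 2)
    (hB : eulerP α = B * eulerP (2 * α)) (hC : eulerP (4 * β) = C * eulerP (2 * β))
    (pB : 0 ≤ B) (pC : 0 ≤ C) :
    Real.sqrt 2 * Real.exp (α / 24) * B =
      Real.exp (-β / 12) * ((1 + Real.exp (-(2 * ((0 : ℕ) : ℝ)) * β)) * C) := by
  have s1 := etaR_sq α (4 * β) hα (by positivity) (by linarith)
  have s2 := etaR_sq (2 * α) (2 * β) (by positivity) (by positivity) (by linarith)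
  have f1 : etaR α = Real.exp (α / 24) * B * etaR (2 * α) := by
    unfold etaR
    have : Real.exp (-α / 24) = Real.exp (α / 24) * Real.exp (-(2 * α) / 24) := by
      rw [← Real.exp_add]
      congr 1
      ring
    rw [hB, this]
    ring
  have f2 : etaR (4 * β) = Real.exp (-β / 12) * C * etaR (2 * β) := by
    unfold etaR
    have : Real.exp (-(4 * β) / 24) = Real.exp (-β / 12) * Real.exp (-(2 * β) / 24) := by
      rw [← Real.exp_add]
      congr 1
      ring
    rw [hC, this]
    ring
  have hn := etaR_ne (2 * α) (by positivity)
  rw [f1, f2, mul_pow, s2] at s1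
  have key : 2 * (Real.exp (-β / 12) * C) ^ 2 = (Real.exp (α / 24) * B) ^ 2 := by
    have hk : α / (2 * π) * etaR (2 * α) ^ 2 ≠ 0 := by positivity
    apply mul_right_cancel₀ hk
    linear_combination s1
  have e0 : (1 + Real.exp (-(2 * ((0 : ℕ) : ℝ)) * β)) = 2 := by
    norm_num
  rw [e0]
  have h2 : Real.sqrt 2 ^ 2 = 2 := Real.sq_sqrt (by norm_num)
  rw [← sq_eq_sq₀ (by positivity) (by positivity)]
  linear_combination (Real.exp (α / 24) * B) ^ 2 * h2 - 2 * key

lemma aux_mB (α : ℝ) (hα : 0 < α) : Multipliable fun n : ℕ => 1 - Real.exp (-(2 * (n : ℝ) + 1) * α) := by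
  convert mult_sub (2 * α) α (by positivity) using 4
  ring

lemma aux_mC (β : ℝ) (hβ : 0 < β) : Multipliable fun n : ℕ => 1 + Real.exp (-(2 * ((n + 1 : ℕ) : ℝ)) * β) := by
  convert mult_add (2 * β) (2 * β) (by positivity) using 4
  push_cast
  ring

lemma aux_hB (α : ℝ) (hα : 0 < α) : eulerP α =
    (∏' n : ℕ, (1 - Real.exp (-(2 * (n : ℝ) + 1) * α))) * eulerP (2 * α) := by
  have mB := aux_mB α hα
  unfold eulerP
  rw [← tprod_even_mul_odd (f := fun n : ℕ => 1 - Real.exp (-((n : ℝ) + 1) * α))]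
  · congr 1
    · refine tprod_congr fun n => ?_
      push_cast
      rfl
    · refine tprod_congr fun n => ?_
      push_cast
      congr 2
      ring
  · refine mB.congr fun n => ?_
    push_cast
    rfl
  · refine (mult_eulerP (2 * α) (by positivity)).congr fun n => ?_
    push_cast
    congr 2
    ring

lemma aux_hC (β : ℝ) (hβ : 0 < β) : eulerP (4 * β) =
    (∏' n : ℕ, (1 + Real.exp (-(2 * ((n + 1 : ℕ) : ℝ)) * β))) * eulerP (2 * β) := by
  have mC := aux_mC β hβ
  unfold eulerP
  rw [← Multipliable.tprod_mul mC (mult_eulerP (2 * β) (by positivity))]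
  refine tprod_congr fun n => ?_
  have e1 : Real.exp (-((n : ℝ) + 1) * (4 * β)) = Real.exp (-((n : ℝ) + 1) * (2 * β)) ^ 2 := by
    rw [← Real.exp_nat_mul]
    congr 1
    push_cast
    ring
  have e2 : -(2 * ((n + 1 : ℕ) : ℝ)) * β = -((n : ℝ) + 1) * (2 * β) := by
    push_cast
    ring
  rw [e1, e2]
  ring

lemma aux_pB (α : ℝ) (hα : 0 < α) :
    0 ≤ ∏' n : ℕ, (1 - Real.exp (-(2 * (n : ℝ) + 1) * α)) := by
  refine tprod_nonneg_aux _ (aux_mB α hα) fun n => ?_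
  have h1 : 0 ≤ (2 * (n : ℝ) + 1) * α := by positivity
  have h2 : Real.exp (-(2 * (n : ℝ) + 1) * α) ≤ 1 := Real.exp_le_one_iff.2 (by linarith)
  linarith

lemma aux_pC (β : ℝ) (hβ : 0 < β) :
    0 ≤ ∏' n : ℕ, (1 + Real.exp (-(2 * ((n + 1 : ℕ) : ℝ)) * β)) := by
  refine tprod_nonneg_aux _ (aux_mC β hβ) fun n => ?_
  positivity

theorem eta_product_transformation (α β : ℝ) (hα : 0 < α) (hβ : 0 < β)
    (hab : α * β = π ^ 2) :
    Real.sqrt 2 * Real.exp (α / 24) *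
        (∏' n : ℕ, (1 - Real.exp (-(2 * (n : ℝ) + 1) * α))) =
      Real.exp (-β / 12) * (∏' n : ℕ, (1 + Real.exp (-(2 * (n : ℝ)) * β))) := by
  have hz := tprod_eq_zero_mul' (f := fun n : ℕ => 1 + Real.exp (-(2 * (n : ℝ)) * β))
    (aux_mC β hβ)
  rw [hz]
  exact final_step α β _ _ hα hβ hab (aux_hB α hα) (aux_hC β hβ) (aux_pB α hα) (aux_pC β hβ)
end

section
/- Σ_{n=1}^∞ e^{nπ}/(n(e^{2nπ} − 1)) − Σ_{n=1}^∞ (−1)ⁿ/(n(e^{2nπ} − 1)) = −(1/2)·log 2 + π/8. -/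
open Real

theorem LR_sum_aux {x : ℝ} (h0 : 0 < x) (h1 : x < 1) :
    Summable (fun n : ℕ => x ^ (n + 1) / ((n + 1) * (1 - x ^ (n + 1)))) := by
  have hs : Summable (fun n : ℕ => x ^ (n + 1) / (1 - x)) :=
    ((summable_nat_add_iff 1).mpr (summable_geometric_of_lt_one h0.le h1)).div_const _
  refine hs.of_nonneg_of_le (fun n => ?_) (fun n => ?_)
  · have := pow_lt_one₀ h0.le h1 (Nat.succ_ne_zero n)
    have : 0 < 1 - x ^ (n + 1) := by simpa using this
    positivity
  · have h2 : x ^ (n + 1) ≤ x := pow_le_of_le_one h0.le h1.le (Nat.succ_ne_zero n)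
    have h3 : 0 < 1 - x := by linarith
    have h4 : (0 : ℝ) ≤ n := by positivity
    gcongr
    nlinarith

theorem LR_double {x : ℝ} (h0 : 0 < x) (h1 : x < 1) :
    HasSum (fun k : ℕ => Real.log (1 - x ^ (k + 1)))
      (-∑' n : ℕ, x ^ (n + 1) / ((n + 1) * (1 - x ^ (n + 1)))) := by
  have hrow (n : ℕ) : HasSum (fun k : ℕ => (x ^ (k + 1)) ^ (n + 1) / ((n : ℝ) + 1))
      (x ^ (n + 1) / ((n + 1) * (1 - x ^ (n + 1)))) := by
    have hy := pow_lt_one₀ h0.le h1 (Nat.succ_ne_zero n)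
    have := ((hasSum_geometric_of_lt_one (by positivity) hy).mul_left (x ^ (n + 1))).div_const
      ((n : ℝ) + 1)
    convert! this using 1
    · ext k
      rw [← pow_succ', ← pow_mul, ← pow_mul, mul_comm (k + 1)]
    · rw [Nat.succ_eq_add_one, ← div_eq_mul_inv, div_div, mul_comm (1 - x ^ (n + 1))]
  have hcol (k : ℕ) : HasSum (fun n : ℕ => (x ^ (k + 1)) ^ (n + 1) / ((n : ℝ) + 1))
      (-Real.log (1 - x ^ (k + 1))) := by
    apply hasSum_pow_div_log_of_abs_lt_one
    rw [abs_of_pos (by positivity)]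
    exact pow_lt_one₀ h0.le h1 (Nat.succ_ne_zero k)
  have hs : Summable (fun p : ℕ × ℕ => (x ^ (p.2 + 1)) ^ (p.1 + 1) / ((p.1 : ℝ) + 1)) := by
    refine (summable_prod_of_nonneg (fun _ ↦ by positivity)).mpr ⟨fun n => (hrow n).summable, ?_⟩
    simpa only [(hrow _).tsum_eq] using LR_sum_aux h0 h1
  have hS := hs.hasSum.prod_fiberwise hrow
  have hT := ((Equiv.prodComm ℕ ℕ).hasSum_iff.mpr hs.hasSum).prod_fiberwise hcol
  rw [hS.tsum_eq]
  simpa using! hT.neg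

open ModularForm Complex in
theorem LR_eta {t : ℝ} (ht : 0 < t) :
    ‖ModularForm.eta (Complex.I * t)‖ = Real.exp (-(2 * π * t) / 24 -
      ∑' n : ℕ, Real.exp (-(2 * π * t)) ^ (n + 1) /
        ((n + 1) * (1 - Real.exp (-(2 * π * t)) ^ (n + 1)))) := by
  set x := Real.exp (-(2 * π * t)) with hx
  have h0 : 0 < x := Real.exp_pos _
  have h1 : x < 1 := by
    rw [hx, Real.exp_lt_one_iff]
    have := Real.pi_pos
    have : 0 < 2 * π * t := by positivity
    linarith
  have hq : Function.Periodic.qParam 1 (Complex.I * t) = (x : ℂ) := by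
    rw [Function.Periodic.qParam, hx, Complex.ofReal_exp]
    congr 1
    push_cast
    linear_combination (2 * π * t : ℂ) * Complex.I_sq
  have hm : Multipliable (fun n : ℕ => 1 - (x : ℂ) ^ (n + 1)) :=
    multipliable_one_sub_pow (by rw [Complex.norm_real, Real.norm_of_nonneg h0.le]; exact h1)
  have hpos (n : ℕ) : 0 < 1 - x ^ (n + 1) := by
    have := pow_lt_one₀ h0.le h1 (Nat.succ_ne_zero n)
    simpa using this
  have hd := LR_double h0 h1
  rw [ModularForm.eta, norm_mul]
  simp only [eta_q, hq]
  rw [hm.norm_tprod, sub_eq_add_neg, Real.exp_add, ← hd.tsum_eq,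
    Real.rexp_tsum_eq_tprod hpos hd.summable]
  congr 1
  · rw [Function.Periodic.qParam, Complex.norm_exp]
    congr 1
    have : (2 * π * Complex.I * (Complex.I * t) / (24 : ℝ) : ℂ) = ((-(2 * π * t) / 24 : ℝ) : ℂ) := by
      push_cast
      linear_combination (2 * π * t / 24 : ℂ) * Complex.I_sq
    rw [this, Complex.ofReal_re]
  · congr 1
    ext n
    rw [show (1 - (x : ℂ) ^ (n + 1)) = ((1 - x ^ (n + 1) : ℝ) : ℂ) by push_cast; rfl,
      Complex.norm_real, Real.norm_of_nonneg (hpos n).le]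

theorem LR_norm_sqrt (z : ℂ) : ‖Complex.sqrt z‖ ^ 2 = ‖z‖ := by
  have h := Complex.cpow_nat_inv_pow z two_ne_zero
  rw [← norm_pow, Complex.sqrt]
  push_cast at h
  rw [h]

theorem LR_eta_S : ‖ModularForm.eta (Complex.I * (1 / 2 : ℝ))‖ =
    √2 * ‖ModularForm.eta (Complex.I * (2 : ℝ))‖ := by
  have h := ModularForm.eta_comp_eq_csqrt_I_inv (x := Complex.I * (2 : ℝ)) (by simp)
  simp only [Function.comp_apply, Pi.smul_apply, Pi.mul_apply, smul_eq_mul] at h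
  have h2 : -1 / (Complex.I * (2 : ℝ)) = Complex.I * (1 / 2 : ℝ) := by
    push_cast
    field_simp
    simp
  rw [h2] at h
  rw [h, norm_mul, norm_mul, norm_inv]
  have a1 := LR_norm_sqrt Complex.I
  have a2 := LR_norm_sqrt (Complex.I * (2 : ℝ))
  have b1 : ‖Complex.sqrt Complex.I‖ = 1 := by
    rw [← Real.sqrt_sq (norm_nonneg (Complex.sqrt Complex.I)), a1]; simp
  have b2 : ‖Complex.sqrt (Complex.I * (2 : ℝ))‖ = √2 := by
    rw [← Real.sqrt_sq (norm_nonneg (Complex.sqrt _)), a2]; simp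
  rw [b1, b2]; simp

theorem lagrange_ramanujan :
    (∑' n : ℕ, Real.exp ((n + 1) * π) / ((n + 1) * (Real.exp (2 * (n + 1) * π) - 1))) -
      (∑' n : ℕ, (-1 : ℝ) ^ (n + 1) / ((n + 1) * (Real.exp (2 * (n + 1) * π) - 1))) =
      -(1 / 2) * Real.log 2 + π / 8 := by
  set q := Real.exp (-π) with hq
  have h0 : 0 < q := Real.exp_pos _
  have h1 : q < 1 := by
    rw [hq, Real.exp_lt_one_iff]; linarith [Real.pi_pos]
  let S : ℝ → ℕ → ℝ := fun x n => x ^ (n + 1) / ((n + 1) * (1 - x ^ (n + 1)))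
  have hS1 : Summable (S q) := LR_sum_aux h0 h1
  have hS2 : Summable (S (q ^ 2)) :=
    LR_sum_aux (by positivity) (pow_lt_one₀ h0.le h1 two_ne_zero)
  have hS4 : Summable (S (q ^ 4)) :=
    LR_sum_aux (by positivity) (pow_lt_one₀ h0.le h1 (by norm_num))
  have key : (∑' n, S q n) - ∑' n, S (q ^ 4) n = -(1 / 2) * Real.log 2 + π / 8 := by
    have e := LR_eta_S
    rw [LR_eta (by norm_num), LR_eta (by norm_num)] at e
    have e1 : Real.exp (-(2 * π * (1 / 2))) = q := by rw [hq]; congr 1; ring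
    have e2 : Real.exp (-(2 * π * 2)) = q ^ 4 := by
      rw [hq, ← Real.exp_nat_mul]; congr 1; push_cast; ring
    rw [e1, e2] at e
    have e := congrArg Real.log e
    rw [Real.log_mul (by positivity) (Real.exp_ne_zero _), Real.log_exp, Real.log_exp,
      Real.log_sqrt (by norm_num)] at e
    simp only [S]
    linarith
  have hE (n : ℕ) : Real.exp ((n + 1) * π) = (q ^ (n + 1))⁻¹ := by
    rw [hq, ← Real.exp_nat_mul, ← Real.exp_neg]; congr 1; push_cast; ring
  have hE2 (n : ℕ) : Real.exp (2 * (n + 1) * π) = ((q ^ (n + 1)) ^ 2)⁻¹ := by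
    rw [← inv_pow, ← hE, ← Real.exp_nat_mul]; congr 1; push_cast; ring
  have first : (∑' n : ℕ, Real.exp ((n + 1) * π) / ((n + 1) * (Real.exp (2 * (n + 1) * π) - 1)))
      = (∑' n, S q n) - ∑' n, S (q ^ 2) n := by
    rw [← hS1.tsum_sub hS2]
    congr 1
    ext n
    have hy := pow_lt_one₀ h0.le h1 (Nat.succ_ne_zero n)
    rw [hE, hE2]
    simp only [S]
    rw [← pow_mul q 2, mul_comm 2 (n + 1), pow_mul]
    rw [Nat.succ_eq_add_one] at hy
    have hp : 0 < q ^ (n + 1) := by positivity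
    generalize q ^ (n + 1) = y at *
    have : (1 - y) ≠ 0 := by linarith
    have : (1 - y ^ 2) ≠ 0 := by nlinarith
    have : (n + 1 : ℝ) ≠ 0 := by positivity
    have : (y ^ 2)⁻¹ - 1 = (1 - y ^ 2) / y ^ 2 := by field_simp
    rw [this]
    field_simp
    ring
  have second : (∑' n : ℕ, (-1 : ℝ) ^ (n + 1) / ((n + 1) * (Real.exp (2 * (n + 1) * π) - 1)))
      = (∑' n, S (q ^ 4) n) - ∑' n, S (q ^ 2) n := by
    have ht (n : ℕ) : (-1 : ℝ) ^ (n + 1) / ((n + 1) * (Real.exp (2 * (n + 1) * π) - 1)) =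
        (-1 : ℝ) ^ (n + 1) * S (q ^ 2) n := by
      have hy := pow_lt_one₀ h0.le h1 (Nat.succ_ne_zero n)
      rw [hE2]
      simp only [S]
      rw [← pow_mul q 2, mul_comm 2 (n + 1), pow_mul]
      rw [Nat.succ_eq_add_one] at hy
      have hp : 0 < q ^ (n + 1) := by positivity
      generalize q ^ (n + 1) = y at *
      have : (1 - y ^ 2) ≠ 0 := by nlinarith
      have : (n + 1 : ℝ) ≠ 0 := by positivity
      have : (y ^ 2)⁻¹ - 1 = (1 - y ^ 2) / y ^ 2 := by field_simp
      rw [this]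
      field_simp
    simp only [ht]
    have i0 : Function.Injective (fun k : ℕ => 2 * k) := fun a b h => by simpa using h
    have i1 : Function.Injective (fun k : ℕ => 2 * k + 1) := fun a b h => by simpa using h
    have he := hS2.comp_injective i0
    have ho := hS2.comp_injective i1
    have hodd (k : ℕ) : S (q ^ 2) (2 * k + 1) = S (q ^ 4) k / 2 := by
      simp only [S]
      have : (q ^ 2) ^ (2 * k + 1 + 1) = (q ^ 4) ^ (k + 1) := by
        rw [← pow_mul, ← pow_mul]; congr 1; ring
      rw [this]
      push_cast
      rw [div_div]
      congr 1
      ring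
    have s1 := tsum_even_add_odd he ho
    have g0 (k : ℕ) : (-1 : ℝ) ^ (2 * k + 1) * S (q ^ 2) (2 * k) = - S (q ^ 2) (2 * k) := by
      rw [pow_succ, pow_mul]; simp
    have g1 (k : ℕ) : (-1 : ℝ) ^ (2 * k + 1 + 1) * S (q ^ 2) (2 * k + 1) =
        S (q ^ 2) (2 * k + 1) := by
      rw [show 2 * k + 1 + 1 = 2 * (k + 1) by ring, pow_mul]; simp
    have s2 := tsum_even_add_odd (f := fun n : ℕ => (-1 : ℝ) ^ (n + 1) * S (q ^ 2) n)
      (by simpa only [g0] using! he.neg) (by simpa only [g1] using! ho)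
    simp only [g0, g1, tsum_neg] at s2
    simp only [hodd, tsum_div_const] at s1 s2
    linarith
  rw [first, second]
  linarith
end

section
/- For α, β > 0 with αβ = π², α·Σ_{n=1}^∞ n/(e^{2nα} − 1) + β·Σ_{n=1}^∞ n/(e^{2nβ} − 1) = (α + β)/24 − 1/4. -/
open Real

lemma schlomilch_G2 (a : ℝ) (ha : 0 < a) (z : UpperHalfPlane)
    (hz : (z : ℂ) = Complex.I * (a / π : ℝ)) :
    EisensteinSeries.G2 z = ((π ^ 2 / 3 - 8 * π ^ 2 *
      (∑' n : ℕ, (n + 1) / (Real.exp (2 * (n + 1) * a) - 1)) : ℝ) : ℂ) := by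
  have hq : Complex.exp (2 * π * Complex.I * z) = ((Real.exp (-2 * a) : ℝ) : ℂ) := by
    rw [hz, Complex.ofReal_exp]
    congr 1
    have : (π : ℂ) ≠ 0 := by exact_mod_cast Real.pi_ne_zero
    push_cast
    field_simp
    rw [Complex.I_sq]
    ring
  have hn : ‖((Real.exp (-2 * a) : ℝ) : ℂ)‖ < 1 := by
    rw [Complex.norm_real, Real.norm_eq_abs, abs_of_pos (Real.exp_pos _)]
    exact Real.exp_lt_one_iff.mpr (by linarith)
  rw [EisensteinSeries.G2_eq_tsum_cexp, hq, riemannZeta_two]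
  have h1 := tsum_pow_div_one_sub_eq_tsum_sigma hn 1
  rw [← h1, tsum_pnat_eq_tsum_succ (f := fun n : ℕ ↦
    (n : ℂ) ^ 1 * ((Real.exp (-2 * a) : ℝ) : ℂ) ^ n / (1 - ((Real.exp (-2 * a) : ℝ) : ℂ) ^ n))]
  have h2 : ∀ n : ℕ, (((n + 1 : ℕ) : ℂ) ^ 1 * ((Real.exp (-2 * a) : ℝ) : ℂ) ^ (n + 1) /
      (1 - ((Real.exp (-2 * a) : ℝ) : ℂ) ^ (n + 1))) =
      (((n + 1) / (Real.exp (2 * (n + 1) * a) - 1) : ℝ) : ℂ) := by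
    intro n
    have e : Real.exp (-2 * a) ^ (n + 1) = (Real.exp (2 * (n + 1) * a))⁻¹ := by
      rw [← Real.exp_nat_mul, ← Real.exp_neg]
      congr 1
      push_cast
      ring
    have hp : 1 < Real.exp (2 * (n + 1) * a) := Real.one_lt_exp_iff.mpr (by positivity)
    have key : ((n + 1 : ℕ) : ℝ) ^ 1 * Real.exp (-2 * a) ^ (n + 1) /
        (1 - Real.exp (-2 * a) ^ (n + 1)) = (n + 1) / (Real.exp (2 * (n + 1) * a) - 1) := by
      rw [e]
      generalize Real.exp (2 * (n + 1) * a) = x at hp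
      have h0 : x ≠ 0 := by linarith
      have h3 : x - 1 ≠ 0 := by linarith
      have h4 : 1 - x⁻¹ ≠ 0 := by
        have : 1 - x⁻¹ = (x - 1) / x := by field_simp
        rw [this]
        exact div_ne_zero h3 h0
      rw [div_eq_div_iff h4 h3]
      push_cast
      field_simp
    rw [← key]
    push_cast
    rfl
  rw [tsum_congr h2, ← Complex.ofReal_tsum]
  push_cast
  ring

theorem schlomilch_formula (α β : ℝ) (hα : 0 < α) (hβ : 0 < β) (hab : α * β = π ^ 2) :
    α * (∑' n : ℕ, (n + 1) / (Real.exp (2 * (n + 1) * α) - 1)) +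
      β * (∑' n : ℕ, (n + 1) / (Real.exp (2 * (n + 1) * β) - 1)) =
      (α + β) / 24 - 1 / 4 := by
  have hpi := Real.pi_pos
  have hπ : (π : ℂ) ≠ 0 := by exact_mod_cast hpi.ne'
  have hα' : (α : ℂ) ≠ 0 := by exact_mod_cast hα.ne'
  have hab' : (α : ℂ) * β = π ^ 2 := by exact_mod_cast hab
  let z : UpperHalfPlane := ⟨Complex.I * (α / π : ℝ), by
    rw [Complex.I_mul_im, Complex.ofReal_re]; positivity⟩
  have hz : (z : ℂ) = Complex.I * (α / π : ℝ) := rfl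
  have hS : ((ModularGroup.S • z : UpperHalfPlane) : ℂ) = Complex.I * (β / π : ℝ) := by
    rw [UpperHalfPlane.modular_S_smul, UpperHalfPlane.coe_mk, hz]
    have hI := Complex.I_ne_zero
    push_cast
    apply inv_eq_of_mul_eq_one_right
    field_simp
    rw [Complex.I_sq]
    linear_combination hab'
  have h := EisensteinSeries.G2_S_transform z
  rw [schlomilch_G2 α hα z hz, schlomilch_G2 β hβ _ hS, hz] at h
  generalize (∑' n : ℕ, (n + 1) / (Real.exp (2 * (n + 1) * α) - 1)) = A at h ⊢
  generalize (∑' n : ℕ, (n + 1) / (Real.exp (2 * (n + 1) * β) - 1)) = B at h ⊢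
  have e1 : ((Complex.I * ((α / π : ℝ) : ℂ)) ^ 2)⁻¹ = ((-(π ^ 2 / α ^ 2) : ℝ) : ℂ) := by
    rw [mul_pow, Complex.I_sq]
    push_cast
    field_simp
  have e2 : -2 * π * Complex.I / (Complex.I * ((α / π : ℝ) : ℂ)) =
      ((-2 * π ^ 2 / α : ℝ) : ℂ) := by
    have hI := Complex.I_ne_zero
    push_cast
    field_simp
  rw [e1, e2] at h
  have h' : π ^ 2 / 3 - 8 * π ^ 2 * A =
      -(π ^ 2 / α ^ 2) * (π ^ 2 / 3 - 8 * π ^ 2 * B) - -2 * π ^ 2 / α := by exact_mod_cast h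
  rw [← hab] at h'
  field_simp at h'
  linarith
end

section
/- Σ_{n=1}^∞ n·e^{nπ}/(e^{2πn} − 1) + Σ_{n=1}^∞ n·(−1)ⁿ/(e^{2πn} − 1) = 1/8 − 1/(4π). -/
open Real

noncomputable def lamA (x : ℝ) : ℝ := ∑' n : ℕ, (n : ℝ) * x ^ n / (1 - x ^ n)

lemma lamA_summable {x : ℝ} (h0 : 0 < x) (h1 : x < 1) :
    Summable fun n : ℕ => (n : ℝ) * x ^ n / (1 - x ^ n) := by
  have := summable_norm_pow_mul_geometric_div_one_sub (𝕜 := ℝ) 1 (r := x)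
    (by rwa [Real.norm_of_nonneg h0.le])
  simpa using this

lemma G2_it (z : UpperHalfPlane) (t : ℝ) (ht : 0 < t) (hz : (z : ℂ) = Complex.I * t) :
    EisensteinSeries.G2 z = ((π ^ 2 / 3 - 8 * π ^ 2 * lamA (Real.exp (-(2 * π * t))) : ℝ) : ℂ) := by
  have hq : Complex.exp (2 * π * Complex.I * z) = ((Real.exp (-(2 * π * t)) : ℝ) : ℂ) := by
    rw [hz, Complex.ofReal_exp]
    congr 1
    push_cast
    linear_combination (2 * π * t : ℂ) * Complex.I_mul_I
  have hlt : Real.exp (-(2 * π * t)) < 1 := by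
    rw [Real.exp_lt_one_iff]
    have : 0 < 2 * π * t := by positivity
    linarith
  rw [EisensteinSeries.G2_eq_tsum_cexp, riemannZeta_two, hq]
  have h1 := tsum_pow_div_one_sub_eq_tsum_sigma (𝕜 := ℂ) (r := ((Real.exp (-(2 * π * t)) : ℝ) : ℂ))
    (by rw [Complex.norm_real, Real.norm_of_nonneg (Real.exp_pos _).le]; exact hlt) 1
  rw [← h1]
  have h2 := tsum_pnat_eq_tsum_succ (f := fun n : ℕ => (n : ℂ) ^ 1 *
    ((Real.exp (-(2 * π * t)) : ℝ) : ℂ) ^ n / (1 - ((Real.exp (-(2 * π * t)) : ℝ) : ℂ) ^ n))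
  rw [h2]
  have h3 := (lamA_summable (Real.exp_pos (-(2 * π * t))) hlt).tsum_eq_zero_add
  rw [lamA, h3]
  push_cast
  simp
  ring

lemma lamA_rel : lamA (Real.exp (-π)) + 4 * lamA (Real.exp (-(4 * π))) = 5 / 24 - 1 / (2 * π) := by
  let z : UpperHalfPlane := ⟨Complex.I * (2 : ℝ), by simp⟩
  have h := EisensteinSeries.G2_S_transform z
  rw [G2_it z 2 (by norm_num) rfl, G2_it (ModularGroup.S • z) (1 / 2) (by norm_num) (by
    rw [UpperHalfPlane.modular_S_smul]
    change (-(Complex.I * (2 : ℝ)))⁻¹ = _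
    push_cast
    rw [inv_neg, mul_inv, Complex.inv_I]
    ring)] at h
  have hz : (z : ℂ) = Complex.I * 2 := by change Complex.I * (2 : ℝ) = _; simp
  have h1 : -2 * (π : ℂ) * Complex.I / z = -π := by
    rw [hz]; field_simp [Complex.I_ne_zero]
  have h2 : ((z : ℂ) ^ 2)⁻¹ = -(1 / 4) := by
    rw [hz, mul_pow, Complex.I_sq]; norm_num
  rw [h1, h2] at h
  have h' : π ^ 2 / 3 - 8 * π ^ 2 * lamA (Real.exp (-(2 * π * 2))) =
    -(1 / 4) * (π ^ 2 / 3 - 8 * π ^ 2 * lamA (Real.exp (-(2 * π * (1 / 2))))) - -π := by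
    apply Complex.ofReal_injective
    push_cast at h ⊢
    exact h
  rw [show 2 * π * 2 = 4 * π by ring, show 2 * π * (1 / 2) = π by ring] at h'
  have hp := pi_pos
  generalize lamA (Real.exp (-(4 * π))) = a at *
  field_simp
  apply mul_left_cancel₀ hp.ne'
  linear_combination (-24) * h'

lemma lamA_two : lamA (Real.exp (-(2 * π))) = 1 / 24 - 1 / (8 * π) := by
  let z : UpperHalfPlane := ⟨Complex.I * (1 : ℝ), by simp⟩
  have h := EisensteinSeries.G2_S_transform z
  rw [G2_it z 1 (by norm_num) rfl, G2_it (ModularGroup.S • z) 1 (by norm_num) (by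
    rw [UpperHalfPlane.modular_S_smul]
    change (-(Complex.I * (1 : ℝ)))⁻¹ = _
    push_cast
    rw [inv_neg, mul_inv, Complex.inv_I]
    simp)] at h
  have hz : (z : ℂ) = Complex.I := by change Complex.I * (1 : ℝ) = _; simp
  have h1 : -2 * (π : ℂ) * Complex.I / z = -2 * π := by
    rw [hz]; field_simp [Complex.I_ne_zero]
  have h2 : ((z : ℂ) ^ 2)⁻¹ = -1 := by
    rw [hz, Complex.I_sq]; norm_num
  rw [h1, h2] at h
  have h' : π ^ 2 / 3 - 8 * π ^ 2 * lamA (Real.exp (-(2 * π * 1))) =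
    -1 * (π ^ 2 / 3 - 8 * π ^ 2 * lamA (Real.exp (-(2 * π * 1)))) - -2 * π := by
    exact_mod_cast h
  rw [mul_one] at h'
  have hp := pi_pos
  field_simp
  apply mul_left_cancel₀ hp.ne'
  linear_combination (-12) * h'

lemma first_sum {q : ℝ} (h0 : 0 < q) (h1 : q < 1) :
    ∑' n : ℕ, ((n : ℝ) + 1) * q⁻¹ ^ (n + 1) / (q⁻¹ ^ (2 * (n + 1)) - 1) =
      lamA q - lamA (q ^ 2) := by
  have s1 := lamA_summable h0 h1
  have s2 := lamA_summable (pow_pos h0 2) (pow_lt_one₀ h0.le h1 two_ne_zero)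
  rw [lamA, lamA, ← s1.tsum_sub s2, (s1.sub s2).tsum_eq_zero_add]
  simp only [Nat.cast_zero, zero_mul, zero_div, sub_zero, zero_add]
  refine tsum_congr fun n => ?_
  have hx0 : 0 < q ^ (n + 1) := pow_pos h0 _
  have hx1 : q ^ (n + 1) < 1 := pow_lt_one₀ h0.le h1 (by omega)
  rw [inv_pow, inv_pow, ← pow_mul q 2, mul_comm 2 (n+1), pow_mul q (n + 1) 2]
  generalize q ^ (n + 1) = x at *
  have e1 : 1 - x ≠ 0 := by linarith
  have e3 : 1 - x ^ 2 ≠ 0 := by nlinarith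
  have e4 : (x ^ 2)⁻¹ - 1 ≠ 0 := by
    intro h; apply e3; field_simp at h; linarith
  push_cast
  rw [div_sub_div _ _ e1 e3, div_eq_div_iff e4 (mul_ne_zero e1 e3)]
  field_simp
  ring

lemma second_sum {p : ℝ} (h0 : 0 < p) (h1 : p < 1) :
    ∑' n : ℕ, ((n : ℝ) + 1) * (-1 : ℝ) ^ (n + 1) / (p⁻¹ ^ (n + 1) - 1) =
      4 * lamA (p ^ 2) - lamA p := by
  have s1 := lamA_summable h0 h1
  have s2 := lamA_summable (pow_pos h0 2) (pow_lt_one₀ h0.le h1 two_ne_zero)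
  set f : ℕ → ℝ := fun n => (n : ℝ) * p ^ n / (1 - p ^ n) with hf
  have se : Summable fun k => f (2 * k) :=
    s1.comp_injective (fun a b h => by simpa using h)
  have so : Summable fun k => f (2 * k + 1) :=
    s1.comp_injective (fun a b h => by simpa using h)
  have ht := tsum_even_add_odd se so
  have hg := tsum_even_add_odd (f := fun n => (-1 : ℝ) ^ n * f n)
    (by simpa [pow_mul] using se) (by simpa [pow_succ, pow_mul] using so.neg)
  have sg : Summable fun n => (-1 : ℝ) ^ n * f n := by
    refine Summable.of_norm ?_
    simpa using s1.norm
  have he : ∑' k, f (2 * k) = 2 * lamA (p ^ 2) := by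
    rw [lamA, ← tsum_mul_left]
    refine tsum_congr fun k => ?_
    simp only [hf, pow_mul]
    push_cast
    ring
  have w1 : ∀ k : ℕ, (-1 : ℝ) ^ (2 * k) = 1 := fun k => by simp [pow_mul]
  have w2 : ∀ k : ℕ, (-1 : ℝ) ^ (2 * k + 1) = -1 := fun k => by simp [pow_succ, pow_mul]
  simp only [w1, w2, one_mul, neg_mul, tsum_neg] at hg
  have hl : lamA p = ∑' n, f n := rfl
  have key : ∑' n, (-1 : ℝ) ^ n * f n = 4 * lamA (p ^ 2) - lamA p := by
    rw [hl]; linarith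
  rw [← key, sg.tsum_eq_zero_add]
  simp only [hf, Nat.cast_zero, zero_mul, zero_div, mul_zero, zero_add]
  refine tsum_congr fun n => ?_
  have hx0 : 0 < p ^ (n + 1) := pow_pos h0 _
  have hx1 : p ^ (n + 1) < 1 := pow_lt_one₀ h0.le h1 (by omega)
  rw [inv_pow]
  generalize p ^ (n + 1) = x at *
  have e1 : 1 - x ≠ 0 := by linarith
  have e4 : x⁻¹ - 1 ≠ 0 := by
    intro h; apply e1; field_simp at h; linarith
  push_cast
  rw [← mul_div_assoc, div_eq_div_iff e4 e1]
  field_simp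

theorem schlomilch_analogue :
    (∑' n : ℕ, (n + 1) * Real.exp ((n + 1) * π) / (Real.exp (2 * π * (n + 1)) - 1)) +
      (∑' n : ℕ, (n + 1) * (-1 : ℝ) ^ (n + 1) / (Real.exp (2 * π * (n + 1)) - 1)) =
      1 / 8 - 1 / (4 * π) := by
  have hp := pi_pos
  have a1 := first_sum (Real.exp_pos (-π)) (by rw [Real.exp_lt_one_iff]; linarith)
  have a2 := second_sum (Real.exp_pos (-(2 * π))) (by rw [Real.exp_lt_one_iff]; linarith)
  have c1 : Real.exp (-π) ^ 2 = Real.exp (-(2 * π)) := by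
    rw [← Real.exp_nat_mul]; congr 1; push_cast; ring
  have c2 : Real.exp (-(2 * π)) ^ 2 = Real.exp (-(4 * π)) := by
    rw [← Real.exp_nat_mul]; congr 1; push_cast; ring
  rw [c1] at a1
  rw [c2] at a2
  have b1 : ∀ n : ℕ, (Real.exp (-π))⁻¹ ^ (n + 1) = Real.exp ((n + 1) * π) := fun n => by
    rw [← Real.exp_neg, neg_neg, ← Real.exp_nat_mul]; push_cast; rfl
  have b2 : ∀ n : ℕ, (Real.exp (-π))⁻¹ ^ (2 * (n + 1)) = Real.exp (2 * π * (n + 1)) := fun n => by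
    rw [← Real.exp_neg, neg_neg, ← Real.exp_nat_mul]; congr 1; push_cast; ring
  have b3 : ∀ n : ℕ, (Real.exp (-(2 * π)))⁻¹ ^ (n + 1) = Real.exp (2 * π * (n + 1)) := fun n => by
    rw [← Real.exp_neg, neg_neg, ← Real.exp_nat_mul]; congr 1; push_cast; ring
  simp only [b1, b2] at a1
  simp only [b3] at a2
  rw [a1, a2]
  have r1 := lamA_rel
  have r2 := lamA_two
  have : 1 / (2 * π) = 2 * (1 / (4 * π)) := by field_simp; norm_num
  have : 1 / (8 * π) = (1 / (4 * π)) / 2 := by field_simp; norm_num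
  linarith
end

section
/- Σ_{n=1}^∞ n/(e^{2nπ} − 1) = 1/24 − 1/(8π). -/
open Real

theorem schlomilch_aux : EisensteinSeries.G2 UpperHalfPlane.I = (π : ℂ) := by
  have h := EisensteinSeries.G2_S_transform UpperHalfPlane.I
  have hS : ModularGroup.S • UpperHalfPlane.I = UpperHalfPlane.I := by
    apply UpperHalfPlane.ext_re_im
    · rw [UpperHalfPlane.modular_S_smul]; simp
    · rw [UpperHalfPlane.modular_S_smul]; simp
  rw [hS] at h
  simp only [UpperHalfPlane.coe_I, Complex.I_sq] at h
  have hI : -2 * (π : ℂ) * Complex.I / Complex.I = -2 * π := by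
    field_simp [Complex.I_ne_zero]
  rw [hI] at h
  have h2 : ((-1 : ℂ))⁻¹ = -1 := by norm_num
  rw [h2] at h
  linear_combination h / 2

theorem schlomilch_classical :
    (∑' n : ℕ, (n + 1) / (Real.exp (2 * (n + 1) * π) - 1)) = 1 / 24 - 1 / (8 * π) := by
  have h := EisensteinSeries.G2_eq_tsum_cexp UpperHalfPlane.I
  have hq := UpperHalfPlane.norm_exp_two_pi_I_lt_one UpperHalfPlane.I
  have hs := tsum_pow_div_one_sub_eq_tsum_sigma hq 1
  have he : Complex.exp (2 * π * Complex.I * (UpperHalfPlane.I : ℂ))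
      = ((Real.exp (-(2 * π)) : ℝ) : ℂ) := by
    push_cast
    congr 1
    linear_combination (2 * (π : ℂ)) * Complex.I_mul_I
  rw [schlomilch_aux, ← hs, riemannZeta_two, he] at h
  rw [tsum_pnat_eq_tsum_succ (f := fun n : ℕ ↦ (n : ℂ) ^ 1 *
    ((Real.exp (-(2 * π)) : ℝ) : ℂ) ^ n / (1 - ((Real.exp (-(2 * π)) : ℝ) : ℂ) ^ n))] at h
  have ht : ∀ n : ℕ, ((n + 1 : ℕ) : ℂ) ^ 1 *
      ((Real.exp (-(2 * π)) : ℝ) : ℂ) ^ (n + 1) / (1 - ((Real.exp (-(2 * π)) : ℝ) : ℂ) ^ (n + 1))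
      = (((n + 1) / (Real.exp (2 * (n + 1) * π) - 1) : ℝ) : ℂ) := by
    intro n
    rw [← Complex.ofReal_pow, ← Real.exp_nat_mul]
    rw [show ((n : ℝ) + 1) = ((n + 1 : ℕ) : ℝ) by push_cast; rfl, pow_one, ← Complex.ofReal_natCast]
    rw [← Complex.ofReal_mul, ← Complex.ofReal_one, ← Complex.ofReal_sub, ← Complex.ofReal_div]
    congr 1
    have e1 : ((n + 1 : ℕ) : ℝ) * -(2 * π) = -(2 * ((n + 1 : ℕ) : ℝ) * π) := by ring
    have hpos : 0 < 2 * ((n + 1 : ℕ) : ℝ) * π := by positivity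
    have h1 : 1 < Real.exp (2 * ((n + 1 : ℕ) : ℝ) * π) := Real.one_lt_exp_iff.mpr hpos
    rw [e1, Real.exp_neg]
    generalize Real.exp (2 * ((n + 1 : ℕ) : ℝ) * π) = x at *
    have hx : x ≠ 0 := by linarith
    have hx1 : x - 1 ≠ 0 := by linarith
    have hx2 : 1 - x⁻¹ ≠ 0 := by
      rw [show 1 - x⁻¹ = (x - 1) / x by field_simp]
      exact div_ne_zero hx1 hx
    field_simp
  rw [tsum_congr ht, ← Complex.ofReal_tsum] at h
  have h' : π = 2 * (π ^ 2 / 6) - 8 * π ^ 2 *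
      ∑' n : ℕ, ((n : ℝ) + 1) / (Real.exp (2 * (n + 1) * π) - 1) := by
    exact_mod_cast h
  generalize (∑' n : ℕ, ((n : ℝ) + 1) / (Real.exp (2 * (n + 1) * π) - 1)) = S at *
  have hp := Real.pi_ne_zero
  have h3 : π * (1 - (π / 3 - 8 * π * S)) = 0 := by linear_combination h'
  have h4 := (mul_eq_zero.mp h3).resolve_left hp
  field_simp
  linear_combination 24 * h4
end

section
/- For an odd positive integer m, ζ(2m+1) + 2·Σ_{n=1}^∞ 1/(n^{2m+1}(e^{2πn} − 1)) = π^{2m+1} · 2^{2m} · Σ_{j=0}^{m+1} (−1)^{j+1} B_{2j} B_{2m+2−2j} / ((2j)!·(2m+2−2j)!), where B_k denotes the k-th Bernoulli number. -/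
open Real Complex Finset

/-- The closed form of `ζ(2k)`. -/
noncomputable def lerchZ (k : ℕ) : ℝ :=
  (-1 : ℝ) ^ (k + 1) * (2 : ℝ) ^ (2 * k - 1) * π ^ (2 * k) *
        bernoulli (2 * k) / (Nat.factorial (2 * k))

lemma lerch_hasSum_Z {k : ℕ} (hk : k ≠ 0) :
    HasSum (fun n : ℕ => 1 / ((n : ℝ) + 1) ^ (2 * k)) (lerchZ k) := by
  have h := (hasSum_nat_add_iff' 1).mpr (hasSum_zeta_nat hk)
  simpa [lerchZ, hk] using h

lemma lerch_coth (N : ℝ) (hN : 0 < N) :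
    1 + 2 / (Real.exp (2 * π * N) - 1) =
      1 / (π * N) + 2 * N / π * ∑' k : ℕ, 1 / (N ^ 2 + ((k : ℝ) + 1) ^ 2) := by
  have hmem : (N * I : ℂ) ∈ Complex.integerComplement := by
    rintro ⟨k, hk⟩
    have := congrArg Complex.im hk
    simp at this
    exact hN.ne this
  have h := cot_series_rep' hmem
  have hE : Complex.exp (2 * π * I * (N * I)) = ((Real.exp (2 * π * N))⁻¹ : ℝ) := by
    rw [← Real.exp_neg]
    push_cast
    congr 1
    ring_nf
    simp
  have hterm : ∀ n : ℕ, (1 / ((N * I : ℂ) - (n + 1)) + 1 / ((N * I : ℂ) + (n + 1))) =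
      (-2 * N * I) * ((1 / (N ^ 2 + ((n : ℝ) + 1) ^ 2) : ℝ) : ℂ) := by
    intro n
    have h1 : (N * I : ℂ) - (n + 1) ≠ 0 := by
      intro h0
      have := congrArg Complex.im h0
      simp at this
      exact hN.ne' this
    have h2 : (N * I : ℂ) + (n + 1) ≠ 0 := by
      intro h0
      have := congrArg Complex.im h0
      simp at this
      exact hN.ne' this
    have h3 : ((N : ℂ) ^ 2 + ((n : ℂ) + 1) ^ 2) ≠ 0 := by
      have : (N ^ 2 + ((n : ℝ) + 1) ^ 2) ≠ 0 := by positivity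
      exact_mod_cast this
    have h4 : ((N * I : ℂ) - (n + 1)) * ((N * I : ℂ) + (n + 1)) =
        - ((N : ℂ) ^ 2 + ((n : ℂ) + 1) ^ 2) := by
      ring_nf
      rw [I_sq]
      ring
    rw [div_add_div _ _ h1 h2, h4]
    push_cast
    field_simp
    ring
  simp_rw [hterm] at h
  rw [tsum_mul_left, ← Complex.ofReal_tsum, Complex.cot_pi_eq_exp_ratio, hE] at h
  set S := ∑' k : ℕ, 1 / (N ^ 2 + ((k : ℝ) + 1) ^ 2)
  set E := Real.exp (2 * π * N) with hEdef
  have hE1 : 1 < E := by rw [hEdef]; exact Real.one_lt_exp_iff.mpr (by positivity)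
  have hE0 : E - 1 ≠ 0 := by linarith
  have hEp : E ≠ 0 := by linarith
  have hreal : π * (E⁻¹ + 1) / (1 - E⁻¹) - 1 / N = 2 * N * S := by
    have h5 : (1 - (E : ℂ)⁻¹) ≠ 0 := by
      have : 1 - E⁻¹ ≠ 0 := by
        have := inv_lt_one_of_one_lt₀ hE1
        linarith
      exact_mod_cast this
    have hNc : (N : ℂ) ≠ 0 := by exact_mod_cast hN.ne'
    have : ((π * (E⁻¹ + 1) / (1 - E⁻¹) - 1 / N : ℝ) : ℂ) = ((2 * N * S : ℝ) : ℂ) := by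
      have h6 := congrArg (fun z => I * z) h
      have hL : I * ((π : ℂ) * ((((E⁻¹ : ℝ) : ℂ) + 1) / (I * (1 - ((E⁻¹ : ℝ) : ℂ)))) - 1 / (N * I))
          = ((π * (E⁻¹ + 1) / (1 - E⁻¹) - 1 / N : ℝ) : ℂ) := by
        push_cast
        have := I_ne_zero
        field_simp
      have hR : I * (-2 * N * I * (S : ℂ)) = ((2 * N * S : ℝ) : ℂ) := by
        push_cast
        linear_combination (-2 * N * S : ℂ) * I_sq
      rw [← hL, ← hR]
      exact h6
    exact_mod_cast this
  have hpi := Real.pi_ne_zero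
  have h7 : (E⁻¹ + 1) / (1 - E⁻¹) = 1 + 2 / (E - 1) := by
    have : 1 - E⁻¹ = (E - 1) / E := by field_simp
    rw [this]
    field_simp
    ring
  rw [mul_div_assoc, h7] at hreal
  have hN' := hN.ne'
  have : 2 * N / π * S = (2 * N * S) / π := by ring
  rw [this, ← hreal]
  field_simp
  ring

lemma lerch_alg (m : ℕ) (hm : Odd m) (x y : ℝ) (hx : 0 < x) (hy : 0 < y) :
    1 / (x ^ (2 * m) * (x ^ 2 + y ^ 2)) + 1 / (y ^ (2 * m) * (y ^ 2 + x ^ 2)) =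
      ∑ i ∈ range m, (-1 : ℝ) ^ i * (1 / x ^ (2 * (i + 1)) * (1 / y ^ (2 * (m - i)))) := by
  have h := geom_sum₂_mul (-(y ^ 2)) (x ^ 2) m
  rw [Odd.neg_pow hm] at h
  have hs : x ^ 2 + y ^ 2 ≠ 0 := by positivity
  have hs' : y ^ 2 + x ^ 2 ≠ 0 := by positivity
  have key : ∑ i ∈ range m, (-1 : ℝ) ^ i * (1 / x ^ (2 * (i + 1)) * (1 / y ^ (2 * (m - i))))
      = (∑ i ∈ range m, (-(y ^ 2)) ^ i * (x ^ 2) ^ (m - 1 - i)) / (x ^ (2 * m) * y ^ (2 * m)) := by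
    rw [Finset.sum_div]
    refine Finset.sum_congr rfl fun i hi => ?_
    obtain ⟨d, rfl⟩ : ∃ d, m = i + 1 + d := ⟨m - (i + 1), by have := mem_range.mp hi; omega⟩
    have e1 : i + 1 + d - i = d + 1 := by omega
    have e2 : i + 1 + d - 1 - i = d := by omega
    rw [e1, e2, neg_pow]
    field_simp
    ring
  rw [key]
  have h2 : ∑ i ∈ range m, (-(y ^ 2)) ^ i * (x ^ 2) ^ (m - 1 - i)
      = ((y ^ 2) ^ m + (x ^ 2) ^ m) / (x ^ 2 + y ^ 2) := by
    rw [eq_div_iff hs]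
    linarith
  rw [h2]
  rw [add_comm (y ^ 2) (x ^ 2)]
  field_simp
  ring

lemma lerch_summable (m : ℕ) (hm0 : 0 < m) :
    Summable (fun p : ℕ × ℕ => 1 / (((p.1 : ℝ) + 1) ^ (2 * m) *
      (((p.1 : ℝ) + 1) ^ 2 + ((p.2 : ℝ) + 1) ^ 2))) := by
  have h1 := (lerch_hasSum_Z (k := m) hm0.ne').summable
  have h2 := (lerch_hasSum_Z (k := 1) one_ne_zero).summable
  have h := h1.mul_of_nonneg h2 (fun n => by positivity) (fun n => by positivity)
  refine Summable.of_nonneg_of_le (fun p => by positivity) (fun p => ?_) h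
  rw [one_div_mul_one_div, mul_one]
  apply one_div_le_one_div_of_le (by positivity)
  apply mul_le_mul_of_nonneg_left _ (by positivity)
  nlinarith [sq_nonneg ((p.1 : ℝ) + 1)]

lemma lerch_double (m : ℕ) (hm : Odd m) (hm0 : 0 < m) :
    2 * (∑' p : ℕ × ℕ, 1 / (((p.1 : ℝ) + 1) ^ (2 * m) *
      (((p.1 : ℝ) + 1) ^ 2 + ((p.2 : ℝ) + 1) ^ 2))) =
    ∑ i ∈ range m, (-1 : ℝ) ^ i * (lerchZ (i + 1) * lerchZ (m - i)) := by
  have h := (lerch_summable m hm0).hasSum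
  have h' := (Equiv.prodComm ℕ ℕ).hasSum_iff.mpr h
  have h2 := h.add h'
  have h3 : HasSum (fun p : ℕ × ℕ => ∑ i ∈ range m, (-1 : ℝ) ^ i *
      (1 / ((p.1 : ℝ) + 1) ^ (2 * (i + 1)) * (1 / ((p.2 : ℝ) + 1) ^ (2 * (m - i)))))
      (∑ i ∈ range m, (-1 : ℝ) ^ i * (lerchZ (i + 1) * lerchZ (m - i))) := by
    refine hasSum_sum fun i hi => HasSum.mul_left _ ?_
    have a1 := lerch_hasSum_Z (k := i + 1) (by omega)
    have a2 := lerch_hasSum_Z (k := m - i) (by have := mem_range.mp hi; omega)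
    have a3 := a1.summable.mul_of_nonneg a2.summable (fun n => by positivity)
      (fun n => by positivity)
    have a4 := a1.mul a2 a3
    exact a4
  rw [two_mul]
  refine h2.unique ?_
  convert! h3 using 2 with p
  rw [← lerch_alg m hm _ _ (by positivity) (by positivity)]
  simp

lemma lerch_real (m : ℕ) (hm : Odd m) (hm0 : 0 < m) :
    HasSum (fun n : ℕ => 1 / ((n : ℝ) + 1) ^ (2 * m + 1) +
        2 * (1 / (((n : ℝ) + 1) ^ (2 * m + 1) * (Real.exp (2 * π * ((n : ℝ) + 1)) - 1))))
      ((∑ i ∈ range m, (-1 : ℝ) ^ i * (lerchZ (i + 1) * lerchZ (m - i)) + lerchZ (m + 1)) / π) := by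
  have hs := lerch_summable m hm0
  have hT := hs.hasSum.prod_fiberwise (fun n => (hs.prod_factor n).hasSum)
  rw [← lerch_double m hm hm0, add_div]
  have hZ := (lerch_hasSum_Z (k := m + 1) (by omega)).div_const π
  have h := ((hT.mul_left 2).div_const π).add hZ
  convert! h using 2 with n
  have hc := lerch_coth ((n : ℝ) + 1) (by positivity)
  have hpi := Real.pi_ne_zero
  have hn : (n : ℝ) + 1 ≠ 0 := by positivity
  simp only [← one_div_mul_one_div]
  rw [tsum_mul_left]
  set S := ∑' k : ℕ, 1 / (((n : ℝ) + 1) ^ 2 + ((k : ℝ) + 1) ^ 2) with hS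
  have e : 1 / ((n : ℝ) + 1) ^ (2 * m + 1) + 2 * (1 / ((n : ℝ) + 1) ^ (2 * m + 1) *
      (1 / (Real.exp (2 * π * ((n : ℝ) + 1)) - 1))) =
      1 / ((n : ℝ) + 1) ^ (2 * m + 1) * (1 + 2 / (Real.exp (2 * π * ((n : ℝ) + 1)) - 1)) := by
    ring
  rw [e, hc]
  field_simp
  ring

theorem lerch_formula (m : ℕ) (hm : Odd m) (hm0 : 0 < m) :
    riemannZeta (2 * m + 1) +
        2 * ((∑' n : ℕ, 1 / (((n : ℝ) + 1) ^ (2 * m + 1) *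
          (Real.exp (2 * π * ((n : ℝ) + 1)) - 1)) : ℝ) : ℂ) =
      (π : ℂ) ^ (2 * m + 1) * 2 ^ (2 * m) *
        ∑ j ∈ Finset.range (m + 2),
          (-1 : ℂ) ^ (j + 1) * ((bernoulli (2 * j) : ℚ) : ℂ) *
            ((bernoulli (2 * m + 2 - 2 * j) : ℚ) : ℂ) /
              ((Nat.factorial (2 * j) : ℂ) * (Nat.factorial (2 * m + 2 - 2 * j) : ℂ)) := by
  have hA : Summable (fun n : ℕ => 1 / ((n : ℝ) + 1) ^ (2 * m + 1)) := by
    have := (summable_nat_add_iff 1).mpr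
      (Real.summable_one_div_nat_pow.mpr (show 1 < 2 * m + 1 by omega))
    simpa using this
  have hR := lerch_real m hm hm0
  have hB : Summable (fun n : ℕ => 1 / (((n : ℝ) + 1) ^ (2 * m + 1) *
      (Real.exp (2 * π * ((n : ℝ) + 1)) - 1))) := by
    have := (hR.summable.sub hA).mul_left (1 / 2)
    refine this.congr fun n => ?_
    ring
  have hsum := (hA.hasSum.add (hB.hasSum.mul_left 2)).unique hR
  have hzeta : riemannZeta (2 * m + 1) =
      ((∑' n : ℕ, 1 / ((n : ℝ) + 1) ^ (2 * m + 1) : ℝ) : ℂ) := by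
    rw [zeta_eq_tsum_one_div_nat_add_one_cpow (by simp; omega), Complex.ofReal_tsum]
    congr 1
    ext n
    push_cast
    rw [← Complex.cpow_natCast]
    push_cast
    rfl
  have hfin : (∑ i ∈ range m, (-1 : ℝ) ^ i * (lerchZ (i + 1) * lerchZ (m - i)) + lerchZ (m + 1)) / π
      = π ^ (2 * m + 1) * 2 ^ (2 * m) *
        ∑ j ∈ Finset.range (m + 2),
          (-1 : ℝ) ^ (j + 1) * ((bernoulli (2 * j) : ℚ) : ℝ) *
            ((bernoulli (2 * m + 2 - 2 * j) : ℚ) : ℝ) /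
              ((Nat.factorial (2 * j) : ℝ) * (Nat.factorial (2 * m + 2 - 2 * j) : ℝ)) := by
    have hpi := Real.pi_ne_zero
    rw [Finset.sum_range_succ, Finset.sum_range_succ', mul_add, mul_add, div_eq_iff hpi, add_mul,
      add_mul, add_assoc]
    congr 1
    · rw [Finset.mul_sum, Finset.sum_mul]
      refine Finset.sum_congr rfl fun i hi => ?_
      obtain ⟨d, rfl⟩ : ∃ d, m = i + 1 + d := ⟨m - (i + 1), by have := mem_range.mp hi; omega⟩
      have e1 : i + 1 + d - i = d + 1 := by omega
      have e2 : 2 * (i + 1 + d) + 2 - 2 * (i + 1) = 2 * (d + 1) := by omega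
      have e3 : 2 * (i + 1) - 1 = 2 * i + 1 := by omega
      have e4 : 2 * (d + 1) - 1 = 2 * d + 1 := by omega
      have hsg : (-1 : ℝ) ^ d = (-1) ^ i := by
        rcases Nat.even_or_odd i with h | h
        · have : Even d := by grind
          rw [h.neg_one_pow, this.neg_one_pow]
        · have : Odd d := by grind
          rw [h.neg_one_pow, this.neg_one_pow]
      have hsq : (-1 : ℝ) ^ i * (-1) ^ i = 1 := by rw [← mul_pow]; simp
      rw [e1, e2, lerchZ, lerchZ, e3, e4]
      simp only [pow_succ (-1 : ℝ), hsg]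
      generalize (-1 : ℝ) ^ i = s at hsq
      have h3 : s ^ 3 = s := by rw [pow_succ, sq, hsq, one_mul]
      field_simp
      rw [h3]
      ring
    · have e1 : 2 * m + 2 - 2 * (m + 1) = 0 := by omega
      have e2 : 2 * (m + 1) - 1 = 2 * m + 1 := by omega
      have e3 : 2 * m + 2 = 2 * (m + 1) := by omega
      rw [e1, lerchZ, e2]
      simp only [pow_succ (-1 : ℝ), hm.neg_one_pow]
      simp [e3]
      field_simp
      ring
  rw [hzeta]
  rw [hfin] at hsum
  have := congrArg (fun x : ℝ => (x : ℂ)) hsum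
  push_cast at this ⊢
  exact this
end

section
/- For α, β > 0 with αβ = π² and any nonzero integer m, α^{−m}·{ (1/2)ζ(2m+1) + Σ_{n=1}^∞ n^{−2m−1}/(e^{2αn} − 1) } = (−β)^{−m}·{ (1/2)ζ(2m+1) + Σ_{n=1}^∞ n^{−2m−1}/(e^{2βn} − 1) } − 2^{2m}·Σ_{j=0}^{m+1} (−1)^j B_{2j} B_{2m+2−2j} / ((2j)!·(2m+2−2j)!) · α^{m+1−j} β^j. -/
open Real Complex Finset

noncomputable def zpt (α : ℝ) (hα : 0 < α) : UpperHalfPlane :=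
  ⟨I * ((α / π : ℝ) : ℂ), by simp; positivity⟩

lemma zpt_coe (α : ℝ) (hα : 0 < α) : ((zpt α hα : UpperHalfPlane) : ℂ) = I * (α / π) := by
  simp [zpt]

lemma zpt_exp (α : ℝ) (hα : 0 < α) :
    cexp (2 * π * I * (zpt α hα : UpperHalfPlane)) = cexp (-2 * α) := by
  rw [zpt_coe]
  congr 1
  have : (π : ℂ) ≠ 0 := by exact_mod_cast pi_ne_zero
  field_simp
  rw [I_sq]; ring

open scoped ModularForm MatrixGroups in
lemma S_zpt (α β : ℝ) (hα : 0 < α) (hβ : 0 < β) (hab : α * β = π ^ 2) :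
    ModularGroup.S • zpt α hα = zpt β hβ := by
  ext
  rw [UpperHalfPlane.modular_S_smul]
  show (-((zpt α hα : UpperHalfPlane) : ℂ))⁻¹ = _
  rw [zpt_coe, zpt_coe]
  have h1 : (π : ℂ) ≠ 0 := by exact_mod_cast pi_ne_zero
  have h2 : (α : ℂ) ≠ 0 := by exact_mod_cast hα.ne'
  have h3 : (α : ℂ) * β = π ^ 2 := by exact_mod_cast hab
  have hI := I_ne_zero
  field_simp
  rw [I_sq]; linear_combination h3

open ArithmeticFunction.sigma in
lemma lambert (α : ℝ) (hα : 0 < α) (k : ℕ) :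
    ∑' n : ℕ, ((n : ℂ) + 1) ^ k / (cexp (2 * (α : ℂ) * ((n : ℂ) + 1)) - 1) =
      ∑' n : ℕ+, (σ k n : ℂ) * cexp (2 * π * I * (zpt α hα : UpperHalfPlane)) ^ (n : ℕ) := by
  have hr : ‖cexp (2 * π * I * (zpt α hα : UpperHalfPlane))‖ < 1 :=
    UpperHalfPlane.norm_exp_two_pi_I_lt_one _
  rw [← tsum_pow_div_one_sub_eq_tsum_sigma hr k]
  rw [tsum_pnat_eq_tsum_succ (f := fun n : ℕ => (n : ℂ) ^ k * cexp (2 * π * I * (zpt α hα : UpperHalfPlane)) ^ n / (1 - cexp (2 * π * I * (zpt α hα : UpperHalfPlane)) ^ n))]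
  refine tsum_congr fun n => ?_
  rw [zpt_exp, ← Complex.exp_nat_mul]
  rw [show ((n + 1 : ℕ) : ℂ) * (-2 * α) = -(2 * α * (n + 1)) by push_cast; ring, Complex.exp_neg]
  have h0 := Complex.exp_ne_zero (2 * α * (n + 1))
  have h1 : cexp (2 * α * (n + 1)) - 1 ≠ 0 := by
    intro h
    have h2 : Real.exp (2 * α * (n + 1)) = 1 := by
      have := sub_eq_zero.mp h
      exact_mod_cast this
    have : 0 < 2 * α * (n + 1) := by positivity
    have := Real.one_lt_exp_iff.mpr this
    linarith
  push_cast
  rw [show 1 - (cexp (2 * α * (n + 1)))⁻¹ = (cexp (2 * α * (n + 1)) - 1) / cexp (2 * α * (n + 1)) by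
    field_simp]
  field_simp

lemma bern_ne (M : ℕ) (hM : M ≠ 0) : ((bernoulli (2 * M) : ℚ) : ℂ) ≠ 0 := by
  intro h
  have h1 := riemannZeta_two_mul_nat hM
  rw [h] at h1
  simp only [mul_zero, zero_div] at h1
  refine riemannZeta_ne_zero_of_one_lt_re ?_ h1
  have : (1 : ℝ) ≤ M := by exact_mod_cast Nat.one_le_iff_ne_zero.mpr hM
  simp; linarith

lemma half_zeta_neg (M : ℕ) :
    riemannZeta (2 * ((-(M + 1 : ℤ) : ℤ) : ℂ) + 1) = - (bernoulli (2 * (M + 1)) : ℂ) / (2 * (M + 1)) := by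
  have := riemannZeta_neg_nat_eq_bernoulli (2 * M + 1)
  rw [show (2 * ((-(M + 1 : ℤ) : ℤ) : ℂ) + 1) = -((2 * M + 1 : ℕ) : ℂ) by push_cast; ring, this,
    show 2 * M + 1 + 1 = 2 * (M + 1) by ring, Odd.neg_one_pow ⟨M, rfl⟩]
  push_cast
  ring

open scoped ModularForm MatrixGroups in
/-- `m = -(M+1)` with `M ≥ 1`. -/
lemma neg_big (α β : ℝ) (hα : 0 < α) (hβ : 0 < β) (hab : α * β = π ^ 2) (M : ℕ) (hM : 1 ≤ M) :
    (α : ℂ) ^ (M + 1) * ((1 / 2) * (-(bernoulli (2 * (M + 1)) : ℂ) / (2 * (M + 1))) +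
        ∑' n : ℕ, ((n : ℂ) + 1) ^ (2 * M + 1) /
          (Complex.exp (2 * (α : ℂ) * ((n : ℂ) + 1)) - 1)) =
      (-(β : ℂ)) ^ (M + 1) * ((1 / 2) * (-(bernoulli (2 * (M + 1)) : ℂ) / (2 * (M + 1))) +
          ∑' n : ℕ, ((n : ℂ) + 1) ^ (2 * M + 1) /
            (Complex.exp (2 * (β : ℂ) * ((n : ℂ) + 1)) - 1)) := by
  have hk : 3 ≤ 2 * (M + 1) := by omega
  have key : ∀ (γ : ℝ) (hγ : 0 < γ), (1 / 2) * (-(bernoulli (2 * (M + 1)) : ℂ) / (2 * (M + 1))) +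
        ∑' n : ℕ, ((n : ℂ) + 1) ^ (2 * M + 1) /
          (Complex.exp (2 * (γ : ℂ) * ((n : ℂ) + 1)) - 1) =
      (1 / 2) * (-(bernoulli (2 * (M + 1)) : ℂ) / (2 * (M + 1))) * ModularForm.E hk (zpt γ hγ) := by
    intro γ hγ
    rw [lambert γ hγ, EisensteinSeries.q_expansion_bernoulli hk ⟨M + 1, by ring⟩ (zpt γ hγ)]
    have hb := bern_ne (M + 1) (by omega)
    have hM' : ((M : ℂ) + 1) ≠ 0 := by exact_mod_cast Nat.succ_ne_zero M
    simp only [zpow_natCast, show 2 * (M + 1) - 1 = 2 * M + 1 by omega]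
    push_cast
    field_simp
    ring
  rw [key α hα, key β hβ]
  have hS : ModularForm.E hk (zpt β hβ) = ((zpt α hα : UpperHalfPlane) : ℂ) ^ (2 * (M + 1)) *
      ModularForm.E hk (zpt α hα) := by
    rw [← S_zpt α β hα hβ hab]
    have h := congr_fun (SlashInvariantForm.slash_action_eqn (ModularForm.E hk)
      (Matrix.SpecialLinearGroup.mapGL ℝ ModularGroup.S) ⟨ModularGroup.S, by simp⟩) (zpt α hα)
    have h' : ((ModularForm.E hk : UpperHalfPlane → ℂ) ∣[((2 * (M + 1) : ℕ) : ℤ)] ModularGroup.S)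
      (zpt α hα) = ModularForm.E hk (zpt α hα) := h
    rw [SlashInvariantForm.slash_S_apply, ← UpperHalfPlane.modular_S_smul, zpow_neg,
      zpow_natCast] at h'
    have hne : ((zpt α hα : UpperHalfPlane) : ℂ) ≠ 0 := UpperHalfPlane.ne_zero _
    rw [← h']
    field_simp
  rw [hS, pow_mul, zpt_coe]
  have h1 : (π : ℂ) ≠ 0 := by exact_mod_cast pi_ne_zero
  have h3 : (α : ℂ) * β = π ^ 2 := by exact_mod_cast hab
  have h4 : (-(β : ℂ)) * (I * (α / π)) ^ 2 = α := by
    field_simp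
    rw [I_sq]
    linear_combination (α : ℂ) * h3
  have h6 : (α : ℂ) ^ (M + 1) = (-(β : ℂ)) ^ (M + 1) * ((I * (α / π)) ^ 2) ^ (M + 1) := by
    rw [← mul_pow, h4]
  rw [h6]
  ring

lemma neg_one_case (α β : ℝ) (hα : 0 < α) (hβ : 0 < β) (hab : α * β = π ^ 2) :
    (α : ℂ) * (-1 / 24 +
        ∑' n : ℕ, ((n : ℂ) + 1) ^ 1 /
          (Complex.exp (2 * (α : ℂ) * ((n : ℂ) + 1)) - 1)) =
      (-(β : ℂ)) * (-1 / 24 +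
          ∑' n : ℕ, ((n : ℂ) + 1) ^ 1 /
            (Complex.exp (2 * (β : ℂ) * ((n : ℂ) + 1)) - 1)) - 1 / 4 := by
  have key : ∀ (γ : ℝ) (hγ : 0 < γ), -1 / 24 +
        ∑' n : ℕ, ((n : ℂ) + 1) ^ 1 /
          (Complex.exp (2 * (γ : ℂ) * ((n : ℂ) + 1)) - 1) =
      - EisensteinSeries.G2 (zpt γ hγ) / (8 * π ^ 2) := by
    intro γ hγ
    rw [lambert γ hγ, EisensteinSeries.G2_eq_tsum_cexp, riemannZeta_two]
    have h1 : (π : ℂ) ≠ 0 := by exact_mod_cast pi_ne_zero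
    field_simp
    ring
  rw [key α hα, key β hβ]
  have := EisensteinSeries.G2_S_transform (zpt α hα)
  rw [S_zpt α β hα hβ hab, zpt_coe] at this
  rw [this]
  have h1 : (π : ℂ) ≠ 0 := by exact_mod_cast pi_ne_zero
  have h2 : (α : ℂ) ≠ 0 := by exact_mod_cast hα.ne'
  have h3 : (α : ℂ) * β = π ^ 2 := by exact_mod_cast hab
  have hI := I_ne_zero
  have h5 : (β : ℂ) = π ^ 2 / α := by field_simp; linear_combination h3
  generalize EisensteinSeries.G2 (zpt β hβ) = G
  rw [h5, mul_pow, I_sq]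
  field_simp
  ring

lemma hasSum_zeta_succ (k : ℕ) (hk : 1 < k) :
    HasSum (fun n : ℕ => (((n : ℂ) + 1) ^ k)⁻¹) (riemannZeta k) := by
  have h0 : Summable (fun n : ℕ => ((n : ℂ) ^ k)⁻¹) := by
    have := (Real.summable_nat_pow_inv (p := k)).mpr hk
    have h2 := (Complex.summable_ofReal (f := fun n : ℕ => ((n : ℝ) ^ k)⁻¹)).mpr this
    simpa using h2
  rw [zeta_nat_eq_tsum_of_gt_one hk]
  simp only [one_div]
  have h1 := (hasSum_nat_add_iff' 1).mpr h0.hasSum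
  simpa [show k ≠ 0 by omega] using h1

lemma geom_id (M : ℕ) (x y : ℂ) (hx : x ≠ 0) (hy : y ≠ 0) (hxy : x - y ≠ 0) :
    (x ^ M)⁻¹ / (x - y) - (y ^ M)⁻¹ / (x - y) =
      -∑ i ∈ Finset.range M, (x ^ (i + 1))⁻¹ * (y ^ (M - i))⁻¹ := by
  induction M with
  | zero => simp
  | succ M ih =>
    have : ∀ i ∈ Finset.range M, (x ^ (i + 1))⁻¹ * (y ^ (M + 1 - i))⁻¹ =
        (x ^ (i + 1))⁻¹ * (y ^ (M - i))⁻¹ * y⁻¹ := by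
      intro i hi
      rw [Finset.mem_range] at hi
      rw [show M + 1 - i = (M - i) + 1 by omega, pow_succ y, mul_inv, mul_assoc]
    rw [Finset.sum_range_succ, Finset.sum_congr rfl this, ← Finset.sum_mul, neg_add, ← neg_mul, ← ih]
    simp only [add_tsub_cancel_left, pow_one]
    field_simp
    ring

lemma coth_series (α β : ℝ) (hα : 0 < α) (hβ : 0 < β) (hab : α * β = π ^ 2) (n : ℕ) :
    1 / 2 + 1 / (cexp (2 * (α : ℂ) * ((n : ℂ) + 1)) - 1) =
      1 / (2 * α * (n + 1)) + ∑' k : ℕ, ((n : ℂ) + 1) / (α * (n + 1) ^ 2 + β * (k + 1) ^ 2) := by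
  have h1 : (π : ℂ) ≠ 0 := by exact_mod_cast pi_ne_zero
  have h2 : (α : ℂ) ≠ 0 := by exact_mod_cast hα.ne'
  have h2b : (β : ℂ) ≠ 0 := by exact_mod_cast hβ.ne'
  have h3 : (α : ℂ) * β = π ^ 2 := by exact_mod_cast hab
  have ha : (n : ℂ) + 1 ≠ 0 := by exact_mod_cast Nat.succ_ne_zero n
  set x : ℂ := I * (α * (n + 1) / π) with hx
  have hxim : x.im = α * (n + 1) / π := by
    rw [hx, show (α * ((n : ℂ) + 1) / π) = ((α * (n + 1) / π : ℝ) : ℂ) by push_cast; ring]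
    simp
  have hxc : x ∈ Complex.integerComplement := by
    rintro ⟨d, hd⟩
    have : x.im = 0 := by rw [← hd]; simp
    rw [hxim] at this
    have : 0 < α * (n + 1) / π := by positivity
    linarith
  have hc := cot_series_rep' hxc
  have hterm : ∀ k : ℕ, (1 / (x - (k + 1)) + 1 / (x + (k + 1))) =
      (2 * π / I) * (((n : ℂ) + 1) / (α * (n + 1) ^ 2 + β * (k + 1) ^ 2)) := by
    intro k
    have := cotTerm_identity hxc k
    simp only [cotTerm] at this
    rw [this]
    have e1 : (x + (k + 1)) * (x - (k + 1)) = - (α * (n + 1) ^ 2 + β * (k + 1) ^ 2) / β := by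
      have : β = π ^ 2 / (α : ℂ) := by field_simp; linear_combination h3
      rw [this, hx]
      field_simp
      ring_nf
      rw [I_sq]; ring
    have hd : (α * ((n : ℂ) + 1) ^ 2 + β * (k + 1) ^ 2) ≠ 0 := by
      have : 0 < (α * ((n : ℝ) + 1) ^ 2 + β * (k + 1) ^ 2) := by positivity
      exact_mod_cast this.ne'
    rw [e1, hx]
    have hI := I_ne_zero
    field_simp
    rw [I_sq]
    linear_combination h3
  simp_rw [hterm] at hc
  rw [tsum_mul_left] at hc
  have hexp : cexp (2 * π * I * x) = (cexp (2 * (α : ℂ) * ((n : ℂ) + 1)))⁻¹ := by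
    rw [← Complex.exp_neg]
    congr 1
    rw [hx]
    field_simp
    rw [I_sq]
  rw [Complex.cot_pi_eq_exp_ratio, hexp] at hc
  have h0 := Complex.exp_ne_zero (2 * α * (n + 1))
  have h1' : cexp (2 * α * (n + 1)) - 1 ≠ 0 := by
    intro h
    have h2 : Real.exp (2 * α * (n + 1)) = 1 := by
      have := sub_eq_zero.mp h
      exact_mod_cast this
    have : 0 < 2 * α * (n + 1) := by positivity
    have := Real.one_lt_exp_iff.mpr this
    linarith
  generalize (∑' k : ℕ, ((n : ℂ) + 1) / (α * (n + 1) ^ 2 + β * (k + 1) ^ 2)) = T at hc ⊢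
  generalize cexp (2 * α * (n + 1)) = e at *
  rw [show 1 - e⁻¹ = (e - 1) / e by field_simp, show e⁻¹ + 1 = (e + 1) / e by field_simp; ring] at hc
  have hI := I_ne_zero
  have hT : T = I / (2 * π) * (π * ((e + 1) / e / (I * ((e - 1) / e))) - 1 / x) := by
    rw [hc]; field_simp
  rw [hT, hx]
  field_simp
  ring

noncomputable def F (α β : ℝ) (M : ℕ) (p : ℕ × ℕ) : ℂ :=
  (((p.1 : ℂ) + 1) ^ (2 * M))⁻¹ / (α * (p.1 + 1) ^ 2 + β * (p.2 + 1) ^ 2)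

lemma F_summable (α β : ℝ) (hα : 0 < α) (hβ : 0 < β) (M : ℕ) (hM : 1 ≤ M) :
    Summable (F α β M) := by
  have hz := (hasSum_zeta_succ 2 (by norm_num)).summable.norm
  have hz2 := (hasSum_zeta_succ (2 * M) (by omega)).summable.norm
  have := (hz2.mul_of_nonneg hz (fun _ => norm_nonneg _) (fun _ => norm_nonneg _)).mul_left β⁻¹
  refine Summable.of_norm_bounded this ?_
  rintro ⟨n, k⟩
  have e : (α * ((n : ℂ) + 1) ^ 2 + β * (k + 1) ^ 2) =
    ((α * ((n : ℝ) + 1) ^ 2 + β * (k + 1) ^ 2 : ℝ) : ℂ) := by push_cast; ring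
  have e2 : ((k : ℂ) + 1) = ((k + 1 : ℝ) : ℂ) := by push_cast; ring
  simp only [F]
  rw [norm_div, e, Complex.norm_real, Real.norm_of_nonneg (by positivity), e2, norm_inv ((_ : ℂ) ^ 2),
    norm_pow ((k + 1 : ℝ) : ℂ), Complex.norm_real, Real.norm_of_nonneg (by positivity : (0:ℝ) ≤ k + 1)]
  rw [div_eq_mul_inv, mul_left_comm, ← mul_inv]
  gcongr
  have : 0 < α * ((n : ℝ) + 1) ^ 2 := by positivity
  linarith

lemma bracket (α β : ℝ) (hα : 0 < α) (hβ : 0 < β) (hab : α * β = π ^ 2) (M : ℕ) (hM : 1 ≤ M) :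
    (1 / 2) * riemannZeta (2 * M + 1 : ℕ) + ∑' n : ℕ, (((n : ℂ) + 1) ^ (2 * M + 1))⁻¹ /
          (cexp (2 * (α : ℂ) * ((n : ℂ) + 1)) - 1) =
      riemannZeta (2 * M + 2 : ℕ) / (2 * α) + ∑' p : ℕ × ℕ, F α β M p := by
  have hF := F_summable α β hα hβ M hM
  have h2 : (α : ℂ) ≠ 0 := by exact_mod_cast hα.ne'
  have z1 := (hasSum_zeta_succ (2 * M + 1) (by omega)).mul_left (1 / 2)
  have z2 := (hasSum_zeta_succ (2 * M + 2) (by omega)).mul_left (1 / (2 * α : ℂ))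
  have z3 := hF.prod.hasSum
  rw [← hF.tsum_prod] at z3
  have z4 := (z2.add z3).sub z1
  have : ∀ n : ℕ, (((n : ℂ) + 1) ^ (2 * M + 1))⁻¹ /
          (cexp (2 * (α : ℂ) * ((n : ℂ) + 1)) - 1) =
      1 / (2 * α : ℂ) * (((n : ℂ) + 1) ^ (2 * M + 2))⁻¹ + ∑' k, F α β M (n, k) -
        1 / 2 * (((n : ℂ) + 1) ^ (2 * M + 1))⁻¹ := by
    intro n
    have ha : (n : ℂ) + 1 ≠ 0 := by exact_mod_cast Nat.succ_ne_zero n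
    have hc := coth_series α β hα hβ hab n
    have e : ∑' k, F α β M (n, k) = (((n : ℂ) + 1) ^ (2 * M + 1))⁻¹ *
        ∑' k : ℕ, ((n : ℂ) + 1) / (α * (n + 1) ^ 2 + β * (k + 1) ^ 2) := by
      rw [← tsum_mul_left]
      refine tsum_congr fun k => ?_
      simp only [F]
      rw [pow_succ]
      field_simp
      ring
    rw [e, eq_sub_of_add_eq' hc.symm]
    rw [pow_succ _ (2 * M + 1)]
    field_simp
    ring
  rw [tsum_congr this, z4.tsum_eq]
  ring

lemma hasSum_mul_aux (f g : ℕ → ℂ) (x y : ℂ) (a : HasSum f x) (b : HasSum g y) :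
    HasSum (fun p : ℕ × ℕ => f p.1 * g p.2) (x * y) :=
  HasSum.mul a b (summable_mul_of_summable_norm a.summable.norm b.summable.norm)

lemma prod_zeta (s t : ℕ) (hs : 1 ≤ s) (ht : 1 ≤ t) :
    HasSum (fun p : ℕ × ℕ => (((p.1 : ℂ) + 1) ^ (2 * s))⁻¹ * (((p.2 : ℂ) + 1) ^ (2 * t))⁻¹)
      (riemannZeta (2 * s : ℕ) * riemannZeta (2 * t : ℕ)) :=
  hasSum_mul_aux (fun n : ℕ => (((n : ℂ) + 1) ^ (2 * s))⁻¹) (fun n : ℕ => (((n : ℂ) + 1) ^ (2 * t))⁻¹)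
    _ _ (hasSum_zeta_succ (2 * s) (by omega)) (hasSum_zeta_succ (2 * t) (by omega))

lemma pos_aux (α β : ℝ) (hα : 0 < α) (hβ : 0 < β) (M : ℕ) (hM : 1 ≤ M) :
    ((α : ℂ) ^ M)⁻¹ * ∑' p : ℕ × ℕ, F α β M p - ((-(β : ℂ)) ^ M)⁻¹ * ∑' p : ℕ × ℕ, F β α M p =
      -∑ i ∈ Finset.range M, ((α : ℂ) ^ (i + 1))⁻¹ * ((-(β : ℂ)) ^ (M - i))⁻¹ *
        (riemannZeta (2 * (i + 1) : ℕ) * riemannZeta (2 * (M - i) : ℕ)) := by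
  have h2 : (α : ℂ) ≠ 0 := by exact_mod_cast hα.ne'
  have h2b : (β : ℂ) ≠ 0 := by exact_mod_cast hβ.ne'
  have a1 := (F_summable α β hα hβ M hM).hasSum.mul_left ((α : ℂ) ^ M)⁻¹
  have a2 := ((Equiv.prodComm ℕ ℕ).hasSum_iff.mpr
    (F_summable β α hβ hα M hM).hasSum).mul_left ((-(β : ℂ)) ^ M)⁻¹
  have a3 := (hasSum_sum (s := Finset.range M) (fun i hi =>
    (prod_zeta (i + 1) (M - i) (by omega) (by have := Finset.mem_range.mp hi; omega)).mul_left
      (((α : ℂ) ^ (i + 1))⁻¹ * ((-(β : ℂ)) ^ (M - i))⁻¹))).neg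
  refine (a1.sub a2).unique ?_
  convert a3 using 2 with p
  obtain ⟨n, k⟩ := p
  have ha : (n : ℂ) + 1 ≠ 0 := by exact_mod_cast Nat.succ_ne_zero n
  have hb : (k : ℂ) + 1 ≠ 0 := by exact_mod_cast Nat.succ_ne_zero k
  have hd : (α * ((n : ℂ) + 1) ^ 2 - (-β * (k + 1) ^ 2)) ≠ 0 := by
    have : 0 < (α * ((n : ℝ) + 1) ^ 2 - (-β * (k + 1) ^ 2)) := by
      have h1 : 0 < α * ((n : ℝ) + 1) ^ 2 := by positivity
      have h2 : 0 < β * ((k : ℝ) + 1) ^ 2 := by positivity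
      linarith
    exact_mod_cast this.ne'
  have g := geom_id M (α * ((n : ℂ) + 1) ^ 2) (-β * (k + 1) ^ 2) (by positivity)
    (mul_ne_zero (neg_ne_zero.mpr h2b) (by positivity)) hd
  simp only [F, Function.comp, Equiv.prodComm_apply, Prod.swap]
  have l : ((α : ℂ) ^ M)⁻¹ * ((((n : ℂ) + 1) ^ (2 * M))⁻¹ / (α * (n + 1) ^ 2 + β * (k + 1) ^ 2)) -
     ((-(β : ℂ)) ^ M)⁻¹ * ((((k : ℂ) + 1) ^ (2 * M))⁻¹ / (β * (k + 1) ^ 2 + α * (n + 1) ^ 2)) =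
      ((α * ((n : ℂ) + 1) ^ 2) ^ M)⁻¹ / (α * (n + 1) ^ 2 - -β * (k + 1) ^ 2) -
      ((-β * ((k : ℂ) + 1) ^ 2) ^ M)⁻¹ / (α * (n + 1) ^ 2 - -β * (k + 1) ^ 2) := by
    rw [show β * ((k : ℂ) + 1) ^ 2 + α * (n + 1) ^ 2 = α * (n + 1) ^ 2 - -β * (k + 1) ^ 2 by ring,
      show α * ((n : ℂ) + 1) ^ 2 + β * (k + 1) ^ 2 = α * (n + 1) ^ 2 - -β * (k + 1) ^ 2 by ring,
      mul_pow, mul_pow, mul_inv, mul_inv, ← pow_mul, ← pow_mul]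
    ring
  rw [l, g]
  congr 1
  refine Finset.sum_congr rfl fun i _ => ?_
  rw [mul_pow, mul_pow, mul_inv, mul_inv, ← pow_mul, ← pow_mul]
  ring

lemma zeta_prod_term (α β : ℝ) (hα : 0 < α) (hβ : 0 < β) (hab : α * β = π ^ 2) (M j : ℕ)
    (hj : j ≤ M + 1) :
    ((α : ℂ) ^ j)⁻¹ * ((-(β : ℂ)) ^ (M + 1 - j))⁻¹ *
        (riemannZeta (2 * j : ℕ) * riemannZeta (2 * (M + 1 - j) : ℕ)) =
    (2 : ℂ) ^ (2 * M) * ((-1 : ℂ) ^ j * (bernoulli (2 * j) : ℂ) * (bernoulli (2 * (M + 1 - j)) : ℂ) /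
      ((Nat.factorial (2 * j) : ℂ) * (Nat.factorial (2 * (M + 1 - j)) : ℂ)) *
        (α : ℂ) ^ (M + 1 - j) * (β : ℂ) ^ j) := by
  obtain ⟨l, hl⟩ : ∃ l, M + 1 = j + l := ⟨M + 1 - j, by omega⟩
  have h2 : (α : ℂ) ≠ 0 := by exact_mod_cast hα.ne'
  have h2b : (β : ℂ) ≠ 0 := by exact_mod_cast hβ.ne'
  have h3 : (α : ℂ) * β = π ^ 2 := by exact_mod_cast hab
  rw [hl, Nat.add_sub_cancel_left]
  have hpow : (2 : ℂ) ^ (2 * M) = 2 ^ (2 * j - 1 : ℤ) * 2 ^ (2 * l - 1 : ℤ) := by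
    rw [← zpow_add₀ (by norm_num), ← zpow_natCast]
    congr 1
    push_cast
    have : (M : ℤ) + 1 = j + l := by exact_mod_cast hl
    linarith
  rw [hpow]
  push_cast
  rw [riemannZeta_two_mul_nat', riemannZeta_two_mul_nat', pow_mul, pow_mul, ← h3, mul_pow, mul_pow,
    neg_pow]
  have f1 : ((Nat.factorial (2 * j) : ℕ) : ℂ) ≠ 0 := by exact_mod_cast Nat.factorial_ne_zero _
  have f2 : ((Nat.factorial (2 * l) : ℕ) : ℂ) ≠ 0 := by exact_mod_cast Nat.factorial_ne_zero _
  have f3 : (-1 : ℂ) ^ l * (-1) ^ l = 1 := by rw [← mul_pow]; simp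
  have f4 : ((-1 : ℂ) ^ l)⁻¹ = (-1) ^ l := inv_eq_of_mul_eq_one_left f3
  rw [mul_inv, f4]
  generalize (2 : ℂ) ^ (2 * j - 1 : ℤ) = A
  generalize (2 : ℂ) ^ (2 * l - 1 : ℤ) = B
  field_simp
  rw [pow_succ, pow_succ]
  linear_combination (-1) ^ j * A * B * (bernoulli (2 * j) : ℂ) * (bernoulli (2 * l) : ℂ) * f3

lemma pos_case (α β : ℝ) (hα : 0 < α) (hβ : 0 < β) (hab : α * β = π ^ 2) (M : ℕ) (hM : 1 ≤ M) :
    ((α : ℂ) ^ M)⁻¹ * ((1 / 2) * riemannZeta (2 * M + 1 : ℕ) +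
        ∑' n : ℕ, (((n : ℂ) + 1) ^ (2 * M + 1))⁻¹ /
          (cexp (2 * (α : ℂ) * ((n : ℂ) + 1)) - 1)) =
    ((-(β : ℂ)) ^ M)⁻¹ * ((1 / 2) * riemannZeta (2 * M + 1 : ℕ) +
        ∑' n : ℕ, (((n : ℂ) + 1) ^ (2 * M + 1))⁻¹ /
          (cexp (2 * (β : ℂ) * ((n : ℂ) + 1)) - 1)) -
    (2 : ℂ) ^ (2 * M) * ∑ j ∈ Finset.range (M + 2),
      ((-1 : ℂ) ^ j * (bernoulli (2 * j) : ℂ) * (bernoulli (2 * (M + 1 - j)) : ℂ) /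
      ((Nat.factorial (2 * j) : ℂ) * (Nat.factorial (2 * (M + 1 - j)) : ℂ)) *
        (α : ℂ) ^ (M + 1 - j) * (β : ℂ) ^ j) := by
  rw [Finset.mul_sum]
  rw [← Finset.sum_congr rfl (fun j hj => zeta_prod_term α β hα hβ hab M j
    (by have := Finset.mem_range.mp hj; omega))]
  rw [bracket α β hα hβ hab M hM, bracket β α hβ hα (by rw [mul_comm]; exact hab) M hM]
  rw [Finset.sum_range_succ, Finset.sum_range_succ']
  have := pos_aux α β hα hβ M hM
  simp only [show ∀ i, M + 1 - (i + 1) = M - i by intro i; omega]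
  have h2 : (α : ℂ) ≠ 0 := by exact_mod_cast hα.ne'
  have h2b : (β : ℂ) ≠ 0 := by exact_mod_cast hβ.ne'
  have h2c : (-β : ℂ) ≠ 0 := neg_ne_zero.mpr h2b
  simp only [Nat.sub_self, Nat.sub_zero, mul_zero, Nat.cast_zero, riemannZeta_zero, pow_zero, inv_one,
    show 2 * (M + 1) = 2 * M + 2 by ring]
  have e1 : ((-β : ℂ) ^ (M + 1))⁻¹ = -((-β : ℂ) ^ M)⁻¹ / β := by
    rw [pow_succ]; field_simp
  have e2 : ((α : ℂ) ^ (M + 1))⁻¹ = ((α : ℂ) ^ M)⁻¹ / α := by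
    rw [pow_succ]; field_simp
  rw [e1, e2]
  linear_combination this

lemma sum_Icc_eq (M : ℕ) (f : ℤ → ℂ) :
    ∑ j ∈ Finset.Icc (0 : ℤ) ((M : ℤ) + 1), f j = ∑ j ∈ Finset.range (M + 2), f (j : ℤ) := by
  have : Finset.Icc (0 : ℤ) ((M : ℤ) + 1) = (Finset.range (M + 2)).map Nat.castEmbedding := by
    ext x
    simp only [Finset.mem_Icc, Finset.mem_map, Finset.mem_range, Nat.castEmbedding_apply]
    constructor
    · rintro ⟨h1, h2⟩
      exact ⟨x.toNat, by omega, by omega⟩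
    · rintro ⟨a, h1, rfl⟩
      omega
  rw [this, Finset.sum_map]
  rfl

theorem ramanujan_zeta_odd (α β : ℝ) (hα : 0 < α) (hβ : 0 < β) (hab : α * β = π ^ 2)
    (m : ℤ) (hm : m ≠ 0) :
    (α : ℂ) ^ (-m) * ((1 / 2) * riemannZeta (2 * (m : ℂ) + 1) +
        ∑' n : ℕ, ((n : ℂ) + 1) ^ (-2 * m - 1) /
          (Complex.exp (2 * (α : ℂ) * ((n : ℂ) + 1)) - 1)) =
      (-(β : ℂ)) ^ (-m) * ((1 / 2) * riemannZeta (2 * (m : ℂ) + 1) +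
          ∑' n : ℕ, ((n : ℂ) + 1) ^ (-2 * m - 1) /
            (Complex.exp (2 * (β : ℂ) * ((n : ℂ) + 1)) - 1)) -
        (2 : ℂ) ^ (2 * m) *
          ∑ j ∈ Finset.Icc (0 : ℤ) (m + 1),
            (-1 : ℂ) ^ j * ((bernoulli (2 * j).toNat : ℚ) : ℂ) *
              ((bernoulli (2 * m + 2 - 2 * j).toNat : ℚ) : ℂ) /
                ((Nat.factorial (2 * j).toNat : ℂ) *
                  (Nat.factorial (2 * m + 2 - 2 * j).toNat : ℂ)) *
              (α : ℂ) ^ (m + 1 - j) * (β : ℂ) ^ j := by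
  obtain ⟨M, rfl | rfl⟩ := m.eq_nat_or_neg
  · have hM : 1 ≤ M := by
      rcases Nat.eq_zero_or_pos M with h | h
      · simp [h] at hm
      · exact h
    have h := pos_case α β hα hβ hab M hM
    rw [sum_Icc_eq]
    have e1 : -2 * (M : ℤ) - 1 = -((2 * M + 1 : ℕ) : ℤ) := by push_cast; ring
    have e2 : (2 * ((M : ℤ) : ℂ) + 1) = ((2 * M + 1 : ℕ) : ℂ) := by push_cast; ring
    have e3 : 2 * (M : ℤ) = ((2 * M : ℕ) : ℤ) := by push_cast; ring
    rw [e1, e2]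
    simp only [zpow_neg, zpow_natCast]
    rw [h]
    congr 1
    rw [e3, zpow_natCast]
    congr 1
    refine Finset.sum_congr rfl fun j hj => ?_
    have hj' := Finset.mem_range.mp hj
    rw [show (2 * (j : ℤ)).toNat = 2 * j by omega,
      show (((2 * M : ℕ) : ℤ) + 2 - 2 * (j : ℤ)).toNat = 2 * (M + 1 - j) by omega,
      show (M : ℤ) + 1 - j = ((M + 1 - j : ℕ) : ℤ) by omega]
    simp only [zpow_natCast]
  · obtain ⟨N, rfl⟩ : ∃ N, M = N + 1 := ⟨M - 1, by
      rcases Nat.eq_zero_or_pos M with h | h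
      · simp [h] at hm
      · omega⟩
    have e1 : -2 * (-((N + 1 : ℕ) : ℤ)) - 1 = ((2 * N + 1 : ℕ) : ℤ) := by push_cast; ring
    have e2 := half_zeta_neg N
    have e3 : -(-((N + 1 : ℕ) : ℤ)) = ((N + 1 : ℕ) : ℤ) := by ring
    rw [e1, e3]
    simp only [zpow_natCast]
    rw [show (-((N + 1 : ℕ) : ℤ)) = -(N + 1 : ℤ) by push_cast; ring, e2]
    rcases Nat.eq_zero_or_pos N with h | h
    · subst h
      have h := neg_one_case α β hα hβ hab
      have hb : (bernoulli 2 : ℂ) = 1 / 6 := by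
        rw [bernoulli_two]; norm_num
      norm_num [hb] at h ⊢
      linear_combination h
    · rw [Finset.Icc_eq_empty (by omega)]
      simpa using neg_big α β hα hβ hab N h
end
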